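/- Let F ∈ K[x_1,…,x_n] be a polynomial of degree d > 0 with F(0,…,0) ≠ 0, and assume one of the coefficients of F equals 1. For each positive integer r, let V_F(r) ⊂ K be the k-vector space spanned by all products Π_α α^{n_α}, where α runs over the nonzero coefficients of F, the n_α are nonnegative integers and Σ_α n_α = r; put d_r = dim_k V_F(r). Put N = binom(n+d, n) − 1. Let g = (g_1,…,g_n) ∈ (O_S^*)^n and suppose the elements g^i = g_1^{i_1}⋯g_n^{i_n}, for i ∈ ℤ_{≥0}^n with i_1+⋯+i_n ≤ d, are linearly nondegenerate over V_F(r) for some positive integer r. Then Σ_{𝔭∈S} v_𝔭^0(F(g)) ≤ (d_r/d_{r−1} − 1)·(N+1)·d·n·max_{1≤i≤n} h(g_i) + (d_r(N+1)/d_{r−1})·(r+1)·h(F) + (d_r(N+1)(N·d_r + d_r − 1)/(2·d_{r−1}))·max{0, 2𝔤−2+|S|}. -/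

import Mathlib

open scoped BigOperators Classical

namespace FunctionFieldGCD

variable {K : Type*} [Field K] {Point : Type*}

/-- Truncated order of vanishing `v_𝔭^0(f) = max {0, v_𝔭(f)}`. -/
noncomputable def v0 (v : Point → K → ℤ) (p : Point) (f : K) : ℤ := max 0 (v p f)

/-- The height `h(f) = Σ_𝔭 −min{0, v_𝔭(f)}` of `f`, counting poles with multiplicity. -/
noncomputable def height (v : Point → K → ℤ) (f : K) : ℤ := ∑ᶠ p : Point, max 0 (-(v p f))

/-- `min {v_𝔭^0(f), v_𝔭^0(g)}` with the convention `v_𝔭^0(0) = +∞`. -/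
noncomputable def minv0 (v : Point → K → ℤ) (p : Point) (f g : K) : ℤ :=
  if f = 0 then v0 v p g else if g = 0 then v0 v p f else min (v0 v p f) (v0 v p g)

/-- `N_{S,gcd}(f,g) = Σ_{𝔭∉S} min{v_𝔭^0(f), v_𝔭^0(g)}`. -/
noncomputable def NSgcd (v : Point → K → ℤ) (S : Set Point) (f g : K) : ℤ :=
  ∑ᶠ p ∈ Sᶜ, minv0 v p f g

/-- `h_gcd(f,g) = Σ_{𝔭} min{v_𝔭^0(f), v_𝔭^0(g)}`. -/
noncomputable def hgcd (v : Point → K → ℤ) (f g : K) : ℤ :=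
  ∑ᶠ p : Point, minv0 v p f g

/-- `N_S(f)`: number of zeros of `f` outside `S`, with multiplicity. -/
noncomputable def NS (v : Point → K → ℤ) (S : Set Point) (f : K) : ℤ :=
  ∑ᶠ p ∈ Sᶜ, v0 v p f

/-- `N̄_S(f)`: number of zeros of `f` outside `S`, without multiplicity. -/
noncomputable def NSbar (v : Point → K → ℤ) (S : Set Point) (f : K) : ℤ :=
  ∑ᶠ p ∈ Sᶜ, min 1 (v0 v p f)

/-- membership in the group `O_S^*` of `S`-units. -/
def IsSUnit (v : Point → K → ℤ) (S : Set Point) (f : K) : Prop :=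
  f ≠ 0 ∧ ∀ p ∉ S, v p f = 0

/-- `f` is a constant, i.e. belongs to (the image of) `k`. -/
def IsConst (k : Type*) [Field k] [Algebra k K] (f : K) : Prop :=
  ∃ c : k, algebraMap k K c = f

/-- Projective height of a finite tuple: `h(f_0,…,f_m) = Σ_𝔭 −min_j v_𝔭(f_j)`. -/
noncomputable def heightProj {ι : Type*} [Fintype ι] (v : Point → K → ℤ) (f : ι → K) : ℤ :=
  ∑ᶠ p : Point,
    -(if h : (Finset.univ : Finset ι).Nonempty then Finset.univ.inf' h fun j => v p (f j) else 0)

/-- `v_𝔭(F) = min_{i ∈ I_F} v_𝔭(a_i)` for a multivariable polynomial `F = Σ a_i x^i`. -/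
noncomputable def vPoly {n : ℕ} (v : Point → K → ℤ) (p : Point) (F : MvPolynomial (Fin n) K) :
    ℤ :=
  if h : F.support.Nonempty then F.support.inf' h fun mm => v p (MvPolynomial.coeff mm F) else 0

/-- The height `h(F) = Σ_𝔭 −v_𝔭(F)` of a multivariable polynomial. -/
noncomputable def hPoly {n : ℕ} (v : Point → K → ℤ) (F : MvPolynomial (Fin n) K) : ℤ :=
  ∑ᶠ p : Point, -(vPoly v p F)

/-- The relevant height `h̃(F) = Σ_𝔭 −min{0, v_𝔭(F)}` of a multivariable polynomial. -/
noncomputable def htilde {n : ℕ} (v : Point → K → ℤ) (F : MvPolynomial (Fin n) K) : ℤ :=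
  ∑ᶠ p : Point, max 0 (-(vPoly v p F))

/-- `max_{1≤i≤n} h(g_i)` (heights are nonnegative, so the `toNat` is harmless). -/
noncomputable def maxHeight {n : ℕ} (v : Point → K → ℤ) (g : Fin n → K) : ℤ :=
  ((Finset.univ.sup fun i => (height v (g i)).toNat : ℕ) : ℤ)

/-- `u^m = u_1^{m_1} ⋯ u_n^{m_n}` for an integer exponent vector `m`. -/
noncomputable def prodZPow {n : ℕ} (u : Fin n → K) (mm : Fin n → ℤ) : K :=
  ∏ j, u j ^ mm j

/-- Coprimality of multivariable polynomials: no common non-unit factor. -/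
def CoprimePoly {n : ℕ} (F G : MvPolynomial (Fin n) K) : Prop :=
  ∀ P : MvPolynomial (Fin n) K, P ∣ F → P ∣ G → IsUnit P

/-- `P` is a monomial `a·x^i`. -/
def IsMonomialPoly {n : ℕ} (P : MvPolynomial (Fin n) K) : Prop :=
  ∃ (mm : Fin n →₀ ℕ) (a : K), P = MvPolynomial.monomial mm a

/-- Axioms expressing that `K`, equipped with the family of normalized order functions
`v_𝔭` indexed by the points `𝔭 ∈ C(k)` of a smooth projective curve `C` of genus `genus`
over the algebraically closed field `k`, is the function field `k(C)`. -/
structure IsFunctionField (k : Type*) [Field k] [Algebra k K]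
    (v : Point → K → ℤ) (genus : ℕ) : Prop where
  v_mul : ∀ (p : Point) (f g : K), f ≠ 0 → g ≠ 0 → v p (f * g) = v p f + v p g
  v_add : ∀ (p : Point) (f g : K), f ≠ 0 → g ≠ 0 → f + g ≠ 0 → min (v p f) (v p g) ≤ v p (f + g)
  v_one : ∀ p : Point, v p (1 : K) = 0
  v_algebraMap : ∀ (p : Point) (c : k), c ≠ 0 → v p (algebraMap k K c) = 0
  exists_uniformizer : ∀ p : Point, ∃ f : K, f ≠ 0 ∧ v p f = 1
  finite_support : ∀ f : K, f ≠ 0 → {p : Point | v p f ≠ 0}.Finite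
  sum_v : ∀ f : K, f ≠ 0 → ∑ᶠ p : Point, v p f = 0
  const_of_nonneg : ∀ f : K, f ≠ 0 → (∀ p : Point, 0 ≤ v p f) → ∃ c : k, algebraMap k K c = f
  riemann_roch : ∀ D : Point →₀ ℤ, 2 * (genus : ℤ) - 2 < D.sum (fun _ d => d) →
    (Module.finrank k
        (Submodule.span k {f : K | f = 0 ∨ ∀ p : Point, -(D p) ≤ v p f}) : ℤ)
      = D.sum (fun _ d => d) + 1 - genus

/-- Axioms for the global derivation `η ↦ η' = dη/dt` on `K` determined by an element
`t` as in Proposition 12 (`dt p` plays the role of `v_𝔭(d_𝔭 t)`). -/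
structure IsGoodDerivation (k : Type*) [Field k] [Algebra k K]
    (v : Point → K → ℤ) (genus : ℕ) (D : K → K) (dt : Point → ℤ) : Prop where
  map_add : ∀ f g : K, D (f + g) = D f + D g
  leibniz : ∀ f g : K, D (f * g) = f * D g + g * D f
  map_const : ∀ c : k, D (algebraMap k K c) = 0
  ker_const : ∀ f : K, D f = 0 → ∃ c : k, algebraMap k K c = f
  v_D_of_vne : ∀ f : K, f ≠ 0 → ∀ p : Point, v p f ≠ 0 →
    D f ≠ 0 ∧ v p (D f) = v p f - 1 - dt p
  v_D_of_veq : ∀ f : K, f ≠ 0 → ∀ p : Point, v p f = 0 → D f ≠ 0 → -(dt p) ≤ v p (D f)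
  sum_dt : ∑ᶠ p : Point, max 0 (dt p) ≤ 3 * (genus : ℤ)

/-- `D_u(F) = Σ_{i∈I_F} ((a_i u^i)' / u^i)·x^i`. -/
noncomputable def Du {n : ℕ} (D : K → K) (u : Fin n → K) (F : MvPolynomial (Fin n) K) :
    MvPolynomial (Fin n) K :=
  ∑ mm ∈ F.support,
    MvPolynomial.monomial mm
      ((D (MvPolynomial.coeff mm F * ∏ j, u j ^ mm j)) / ∏ j, u j ^ mm j)


/-- The `k`-span of the set of nonzero coefficients of `F`; its `r`-th power is the space
`V_F(r)` spanned by all products of `r` coefficients of `F`. -/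
noncomputable def coeffSpan1 {K : Type*} [Field K] (k : Type*) [Field k] [Algebra k K]
    {n : ℕ} (F : MvPolynomial (Fin n) K) : Submodule k K :=
  Submodule.span k ((fun mm => MvPolynomial.coeff mm F) '' ↑F.support)

end FunctionFieldGCD

namespace FunctionFieldGCD
open Polynomial in
theorem exists_deriv_aux (k K : Type*) [Field k] [Field K] [Algebra k K] [CharZero k]
    [Algebra k[X] K] [IsScalarTower k k[X] K]
    (hinj : Function.Injective (algebraMap k[X] K)) [Algebra.IsAlgebraic k[X] K] :
    ∃ D : Derivation k K K, D (algebraMap k[X] K X) = 1 := by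
  have : FaithfulSMul k[X] K := (faithfulSMul_iff_algebraMap_injective _ _).2 hinj
  let := FractionRing.liftAlgebra k[X] K
  have : IsScalarTower k[X] (FractionRing k[X]) K := FractionRing.isScalarTower_liftAlgebra k[X] K
  have : Algebra.IsAlgebraic (FractionRing k[X]) K :=
    (IsFractionRing.comap_isAlgebraic_iff (A := k[X]) (K := FractionRing k[X]) (C := K)).1 inferInstance
  have : CharZero (FractionRing k[X]) :=
    charZero_of_injective_algebraMap (R := k[X]) (IsFractionRing.injective _ _)
  have : Algebra.FormallyEtale k[X] (FractionRing k[X]) :=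
    Algebra.FormallyEtale.of_isLocalization (nonZeroDivisors k[X])
  have : Algebra.FormallyEtale (FractionRing k[X]) K := Algebra.FormallyEtale.of_isSeparable _ _
  have : Algebra.FormallyEtale k[X] K := Algebra.FormallyEtale.comp k[X] (FractionRing k[X]) K
  let D0 : Derivation k k[X] K := Polynomial.mkDerivation k (1 : K)
  let l : TensorProduct k[X] K (Ω[k[X]⁄k]) →ₗ[K] K := D0.liftKaehlerDifferential.liftBaseChange K
  refine ⟨(l.comp (KaehlerDifferential.tensorKaehlerEquivOfFormallyEtale k k[X] K).symm.toLinearMap).compDer (KaehlerDifferential.D k K), ?_⟩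
  have := KaehlerDifferential.tensorKaehlerEquivOfFormallyEtale_symm_D_algebraMap k k[X] K X
  change l ((KaehlerDifferential.tensorKaehlerEquivOfFormallyEtale k k[X] K).symm _) = 1
  refine (congrArg l this).trans ?_
  simp [l, D0, mkDerivation_X]

theorem wronsk_aux {k K : Type*} [Field k] [Field K] [Algebra k K] (D : Derivation k K K)
    (hker : ∀ f : K, D f = 0 → ∃ c : k, algebraMap k K c = f) :
    ∀ (m : ℕ) (f : Fin m → K), LinearIndependent k f → ∀ c : Fin m → K,
      (∀ i < m, ∑ j, c j * (D^[i]) (f j) = 0) → c = 0 := by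
  intro m
  induction m with
  | zero => intro f _ c _; exact Subsingleton.elim _ _
  | succ m ih =>
    intro f hf c hc
    have hf' : LinearIndependent k (fun j : Fin m => f j.castSucc) :=
      hf.comp _ (Fin.castSucc_injective m)
    by_cases hl : c (Fin.last m) = 0
    · have h0 : (fun j : Fin m => c j.castSucc) = 0 := by
        apply ih _ hf'
        intro i hi
        have := hc i (by omega)
        rw [Fin.sum_univ_castSucc, hl] at this
        simpa using this
      funext j
      refine Fin.lastCases hl (fun j => ?_) j
      exact congrFun h0 j
    · exfalso
      set e : Fin (m+1) → K := fun j => c j / c (Fin.last m) with he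
      have hel : e (Fin.last m) = 1 := div_self hl
      have hes : ∀ i < m + 1, ∑ j, e j * (D^[i]) (f j) = 0 := by
        intro i hi
        have := hc i hi
        have h2 : ∑ j, e j * (D^[i]) (f j) = (c (Fin.last m))⁻¹ * ∑ j, c j * (D^[i]) (f j) := by
          rw [Finset.mul_sum]; refine Finset.sum_congr rfl fun j _ => ?_
          simp only [he]; field_simp
        rw [h2, this, mul_zero]
      have h0 : (fun j : Fin m => D (e j.castSucc)) = 0 := by
        apply ih _ hf'
        intro i hi
        have h1 := congrArg D (hes i (by omega))
        have h2 := hes (i+1) (by omega)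
        simp only [map_sum, Derivation.leibniz, smul_eq_mul, map_zero] at h1
        rw [Finset.sum_add_distrib] at h1
        simp only [Function.iterate_succ_apply'] at h2
        rw [h2, zero_add, Fin.sum_univ_castSucc, hel] at h1
        simp only [Derivation.map_one_eq_zero, mul_zero, add_zero] at h1
        rw [← h1]; exact Finset.sum_congr rfl fun j _ => mul_comm _ _
      have h1 : ∀ j : Fin (m+1), ∃ a : k, algebraMap k K a = e j := by
        intro j
        refine Fin.lastCases ⟨1, by simp [hel]⟩ (fun j => hker _ (congrFun h0 j)) j
      choose a ha using h1
      have h2 := hes 0 (by omega)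
      simp only [Function.iterate_zero, id] at h2
      have h3 := Fintype.linearIndependent_iff.1 hf a (by
        rw [← h2]; exact Finset.sum_congr rfl fun j _ => by rw [Algebra.smul_def, ha]) (Fin.last m)
      have := ha (Fin.last m)
      rw [h3, hel] at this
      simp at this

theorem wronsk_ne_zero {k K : Type*} [Field k] [Field K] [Algebra k K] (D : Derivation k K K)
    (hker : ∀ f : K, D f = 0 → ∃ c : k, algebraMap k K c = f)
    (m : ℕ) (f : Fin m → K) (hf : LinearIndependent k f) :
    (Matrix.of fun i j : Fin m => (D^[(i : ℕ)]) (f j)).det ≠ 0 := by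
  intro h
  obtain ⟨c, hc, h⟩ := Matrix.exists_mulVec_eq_zero_iff.2 h
  apply hc
  apply wronsk_aux D hker m f hf c
  intro i hi
  have := congrFun h ⟨i, hi⟩
  simp only [Matrix.mulVec, dotProduct, Matrix.of_apply, Pi.zero_apply] at this
  rw [← this]; exact Finset.sum_congr rfl fun j _ => mul_comm _ _

open Polynomial in
theorem dvd_det_aux {k : Type*} [Field k] {n : ℕ} (G : Matrix (Fin n) (Fin n) k[X]) (c : k)
    (U : Submodule k (Fin n → k))
    (hU : ∀ x ∈ U, ∀ j, (X - C c) ∣ ∑ i, C (x i) * G i j) :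
    (X - C c) ^ (Module.finrank k U) ∣ G.det := by
  obtain ⟨V, hV⟩ := U.exists_isCompl
  let bU := Module.finBasis k U
  let bV := Module.finBasis k V
  let e0 := (bU.prod bV).map (Submodule.prodEquivOfIsCompl U V hV)
  let e := e0.reindex (e0.indexEquiv (Pi.basisFun k (Fin n)))
  let I : Finset (Fin n) := Finset.univ.filter fun i => e i ∈ U
  have hI : Module.finrank k U ≤ I.card := by
    have : (Finset.univ.image fun i : Fin (Module.finrank k U) =>
        (e0.indexEquiv (Pi.basisFun k (Fin n))) (Sum.inl i)) ⊆ I := by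
      intro j hj
      obtain ⟨i, -, rfl⟩ := Finset.mem_image.1 hj
      simp [I, e, e0]
    have h2 := Finset.card_le_card this
    rwa [Finset.card_image_of_injective, Finset.card_univ, Fintype.card_fin] at h2
    intro i j hij
    simpa using hij
  let P : Matrix (Fin n) (Fin n) k := Matrix.of fun i => e i
  have hP : IsUnit P := Matrix.linearIndependent_rows_iff_isUnit.1 e.linearIndependent
  have hPd : IsUnit (P.map C).det := by
    have : (P.map (C : k →+* k[X])).det = C P.det := by
      rw [RingHom.map_det]; rfl
    rw [this]
    exact ((Matrix.isUnit_iff_isUnit_det _).1 hP).map C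
  let dd : Fin n → k[X] := fun i => if e i ∈ U then X - C c else 1
  have hdv : ∀ i j, ∃ q, (P.map C * G) i j = dd i * q := by
    intro i j
    by_cases hi : e i ∈ U
    · obtain ⟨q, hq⟩ := hU _ hi j
      refine ⟨q, ?_⟩
      simp only [dd, if_pos hi]
      rw [← hq, Matrix.mul_apply]; rfl
    · exact ⟨_, by simp only [dd, if_neg hi, one_mul]; rfl⟩
  choose Q hQ using hdv
  have h1 : (P.map C * G).det = (∏ i, dd i) * (Matrix.of Q).det := by
    rw [← Matrix.det_mul_column]
    congr 1
    ext1 i j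
    rw [hQ]; rfl
  have h2 : ∏ i, dd i = (X - C c) ^ I.card := by
    simp only [dd, Finset.prod_ite, Finset.prod_const, I, one_pow, mul_one]
  rw [Matrix.det_mul, h2] at h1
  have : (X - C c) ^ I.card ∣ G.det := by
    rw [← hPd.dvd_mul_left, h1]; exact dvd_mul_right _ _
  exact (pow_dvd_pow _ hI).trans this

open Polynomial in
theorem disc_bound {k : Type*} [Field k] [CharZero k] {B : Type*} [CommRing B] [IsDomain B]
    [Algebra k[X] B] {n : ℕ} (b : Module.Basis (Fin n) k[X] B) (w : Fin n → ℕ)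
    (hdeg : ∀ i j l, n * (b.repr (b i * b j * b l) l).natDegree ≤ w i + w j)
    (T : Finset k) (U : k → Submodule k (Fin n → k))
    (hnil : ∀ c ∈ T, ∀ x ∈ U c, ∀ y : B, ∃ (m : ℕ) (z : B),
      ((∑ i, algebraMap k[X] B (C (x i)) * b i) * y) ^ m = algebraMap k[X] B (X - C c) * z) :
    n * ∑ c ∈ T, Module.finrank k (U c) ≤ 2 * ∑ i, w i := by
  rcases Nat.eq_zero_or_pos n with rfl | hn
  · simp
  let G : Matrix (Fin n) (Fin n) k[X] := Matrix.of fun i j => Algebra.trace k[X] B (b i * b j)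
  have : Module.Finite k[X] B := Module.Finite.of_basis b
  have hG0 : G.det ≠ 0 := by
    intro h
    obtain ⟨c, hc, h⟩ := Matrix.exists_vecMul_eq_zero_iff.2 h
    let x : B := ∑ i, c i • b i
    have hx : x ≠ 0 := by
      intro hx
      exact hc (funext (Fintype.linearIndependent_iff.1 b.linearIndependent c hx))
    have htr : ∀ y : B, Algebra.trace k[X] B (x * y) = 0 := by
      intro y
      rw [← b.sum_repr y, Finset.mul_sum, map_sum]
      refine Finset.sum_eq_zero fun j _ => ?_
      rw [mul_smul_comm, map_smul]
      have := congrFun h j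
      simp only [Matrix.vecMul, dotProduct, Pi.zero_apply, G, Matrix.of_apply] at this
      simp only [x, Finset.sum_mul, map_sum, smul_mul_assoc, map_smul, smul_eq_mul]
      rw [this, mul_zero]
    have hne := Ideal.comap_ne_bot_of_integral_mem (R := k[X]) hx
      (Ideal.mem_span_singleton_self x) (Algebra.IsIntegral.isIntegral x)
    obtain ⟨a, ha, ha0⟩ := Submodule.exists_mem_ne_zero_of_ne_bot hne
    rw [Ideal.mem_comap, Ideal.mem_span_singleton] at ha
    obtain ⟨y, hy⟩ := ha
    have := htr y
    rw [← hy, Algebra.trace_algebraMap_of_basis b] at this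
    simp only [Fintype.card_fin, nsmul_eq_mul, mul_eq_zero, Nat.cast_eq_zero] at this
    rcases this with h | h
    · omega
    · exact ha0 h
  have hdet : n * G.det.natDegree ≤ 2 * ∑ i, w i := by
    have : G.det.natDegree ≤ (2 * ∑ i, w i) / n := by
      rw [Matrix.det_apply]
      refine natDegree_sum_le_of_forall_le _ _ fun σ _ => ?_
      refine (natDegree_smul_le _ _).trans ?_
      rw [Nat.le_div_iff_mul_le hn, mul_comm]
      have h1 := natDegree_prod_le Finset.univ fun i => G (σ i) i
      have h2 : ∀ i, n * (G (σ i) i).natDegree ≤ w (σ i) + w i := by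
        intro i
        have : (G (σ i) i).natDegree ≤ (w (σ i) + w i) / n := by
          simp only [G, Matrix.of_apply]
          rw [Algebra.trace_eq_matrix_trace b, Matrix.trace]
          refine natDegree_sum_le_of_forall_le _ _ fun l _ => ?_
          rw [Nat.le_div_iff_mul_le hn, mul_comm]
          simpa [Matrix.diag, Algebra.leftMulMatrix_eq_repr_mul] using hdeg (σ i) i l
        rw [Nat.le_div_iff_mul_le hn, mul_comm] at this
        exact this
      calc n * (∏ i, G (σ i) i).natDegree ≤ n * ∑ i, (G (σ i) i).natDegree := Nat.mul_le_mul_left _ h1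
        _ = ∑ i, n * (G (σ i) i).natDegree := Finset.mul_sum _ _ _
        _ ≤ ∑ i, (w (σ i) + w i) := Finset.sum_le_sum fun i _ => h2 i
        _ = 2 * ∑ i, w i := by
          rw [Finset.sum_add_distrib, Equiv.sum_comp σ w, two_mul]
    rw [Nat.le_div_iff_mul_le hn, mul_comm] at this
    exact this
  have hroot : ∀ c ∈ T, Module.finrank k (U c) ≤ G.det.roots.count c := by
    intro c hc
    rw [count_roots]
    rw [le_rootMultiplicity_iff hG0]
    apply dvd_det_aux
    intro x hx j
    obtain ⟨m, z, hz⟩ := hnil c hc x hx (b j)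
    set u := (∑ i, algebraMap k[X] B (C (x i)) * b i) * b j with hu
    have h1 : ∑ i, C (x i) * G i j = Algebra.trace k[X] B u := by
      rw [hu, Finset.sum_mul, map_sum]
      refine Finset.sum_congr rfl fun i _ => ?_
      rw [mul_assoc, ← Algebra.smul_def, map_smul, smul_eq_mul]; rfl
    rw [h1, dvd_iff_isRoot, IsRoot.def, Algebra.trace_eq_matrix_trace b]
    have h2 : ((evalRingHom c).mapMatrix (Algebra.leftMulMatrix b u)) ^ m = 0 := by
      rw [← map_pow, ← map_pow, hz, ← Algebra.smul_def, map_smul]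
      ext i j
      simp
    have h3 := (Matrix.isNilpotent_trace_of_isNilpotent ⟨m, h2⟩).eq_zero
    rw [← h3]
    simp [Matrix.trace, eval_finsetSum]
  have hs : ∑ c ∈ T, Module.finrank k (U c) ≤ G.det.natDegree := by
    calc ∑ c ∈ T, Module.finrank k (U c) ≤ ∑ c ∈ T, G.det.roots.count c := Finset.sum_le_sum hroot
      _ ≤ ∑ c ∈ T ∪ G.det.roots.toFinset, G.det.roots.count c :=
        Finset.sum_le_sum_of_subset Finset.subset_union_left
      _ = Multiset.card G.det.roots := by
        apply Multiset.sum_count_eq_card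
        intro a ha
        exact Finset.mem_union_right _ (Multiset.mem_toFinset.2 ha)
      _ ≤ _ := card_roots' _
  exact (Nat.mul_le_mul_left _ hs).trans hdet

end FunctionFieldGCD

namespace FunctionFieldGCD
section basics
variable {k K Point : Type*} [Field k] [Field K] [Algebra k K] {v : Point → K → ℤ} {genus : ℕ}

/-- `f` has order at least `a` at `p` (zero has infinite order). -/
def ge (v : Point → K → ℤ) (p : Point) (a : ℤ) (f : K) : Prop := f = 0 ∨ a ≤ v p f

namespace IsFunctionField

theorem v_neg (hK : IsFunctionField k v genus) (p : Point) (f : K) : v p (-f) = v p f := by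
  by_cases hf : f = 0
  · simp [hf]
  have h := hK.v_mul p (algebraMap k K (-1)) f (by simp) hf
  rw [hK.v_algebraMap p (-1) (by simp)] at h
  simpa using h

theorem v_inv (hK : IsFunctionField k v genus) (p : Point) (f : K) (hf : f ≠ 0) :
    v p f⁻¹ = - v p f := by
  have h := hK.v_mul p f f⁻¹ hf (inv_ne_zero hf)
  rw [mul_inv_cancel₀ hf, hK.v_one] at h
  omega

theorem v_div (hK : IsFunctionField k v genus) (p : Point) (f g : K) (hf : f ≠ 0) (hg : g ≠ 0) :
    v p (f / g) = v p f - v p g := by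
  rw [div_eq_mul_inv, hK.v_mul p _ _ hf (inv_ne_zero hg), hK.v_inv p g hg]; ring

theorem v_pow (hK : IsFunctionField k v genus) (p : Point) (f : K) (hf : f ≠ 0) (m : ℕ) :
    v p (f ^ m) = m * v p f := by
  induction m with
  | zero => simp [hK.v_one]
  | succ m ih => rw [pow_succ, hK.v_mul p _ _ (pow_ne_zero _ hf) hf, ih]; push_cast; ring

theorem v_zpow (hK : IsFunctionField k v genus) (p : Point) (f : K) (hf : f ≠ 0) (m : ℤ) :
    v p (f ^ m) = m * v p f := by
  obtain ⟨m, rfl | rfl⟩ := m.eq_nat_or_neg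
  · simp [hK.v_pow p f hf]
  · rw [zpow_neg, zpow_natCast, hK.v_inv p _ (pow_ne_zero _ hf), hK.v_pow p f hf]; ring

theorem ge_zero (_hK : IsFunctionField k v genus) (p : Point) (a : ℤ) : ge v p a 0 := Or.inl rfl

theorem ge_self (_hK : IsFunctionField k v genus) (p : Point) (f : K) : ge v p (v p f) f :=
  Or.inr le_rfl

theorem ge_mono (_hK : IsFunctionField k v genus) {p : Point} {a b : ℤ} {f : K} (hab : a ≤ b)
    (h : ge v p b f) : ge v p a f := h.imp id fun h => hab.trans h

theorem ge_add (hK : IsFunctionField k v genus) {p : Point} {a : ℤ} {f g : K}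
    (hf : ge v p a f) (hg : ge v p a g) : ge v p a (f + g) := by
  by_cases h : f + g = 0
  · exact Or.inl h
  rcases hf with rfl | hf
  · simpa [ge] using hg
  by_cases hg0 : g = 0
  · subst hg0; rw [add_zero]; exact Or.inr hf
  by_cases hf0 : f = 0
  · subst hf0; simpa [ge] using hg
  have := hK.v_add p f g hf0 hg0 h
  rcases hg with hg | hg
  · exact absurd hg hg0
  · exact Or.inr ((le_min hf hg).trans this)

theorem ge_neg (hK : IsFunctionField k v genus) {p : Point} {a : ℤ} {f : K}
    (hf : ge v p a f) : ge v p a (-f) := by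
  rcases hf with rfl | hf
  · simp [ge]
  · exact Or.inr (by rwa [hK.v_neg])

theorem ge_sub (hK : IsFunctionField k v genus) {p : Point} {a : ℤ} {f g : K}
    (hf : ge v p a f) (hg : ge v p a g) : ge v p a (f - g) := by
  rw [sub_eq_add_neg]; exact hK.ge_add hf (hK.ge_neg hg)

theorem ge_mul (hK : IsFunctionField k v genus) {p : Point} {a b : ℤ} {f g : K}
    (hf : ge v p a f) (hg : ge v p b g) : ge v p (a + b) (f * g) := by
  by_cases hf0 : f = 0
  · simp [hf0, ge]
  by_cases hg0 : g = 0
  · simp [hg0, ge]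
  rcases hf with hf | hf
  · exact absurd hf hf0
  rcases hg with hg | hg
  · exact absurd hg hg0
  exact Or.inr (by rw [hK.v_mul p _ _ hf0 hg0]; omega)

theorem ge_const (hK : IsFunctionField k v genus) (p : Point) (c : k) :
    ge v p 0 (algebraMap k K c) := by
  by_cases hc : c = 0
  · simp [hc, ge]
  · exact Or.inr (hK.v_algebraMap p c hc).ge

theorem ge_one (hK : IsFunctionField k v genus) (p : Point) :
    ge v p 0 (1 : K) := Or.inr (hK.v_one p).ge

theorem ge_smul (hK : IsFunctionField k v genus) {p : Point} {a : ℤ} {f : K} (c : k)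
    (hf : ge v p a f) : ge v p a (c • f) := by
  rw [Algebra.smul_def]
  simpa using hK.ge_mul (hK.ge_const p c) hf

theorem ge_natCast (hK : IsFunctionField k v genus) (p : Point) (m : ℕ) :
    ge v p 0 (m : K) := by
  simpa using hK.ge_const p (m : k)

theorem ge_intCast (hK : IsFunctionField k v genus) (p : Point) (m : ℤ) :
    ge v p 0 (m : K) := by
  simpa using hK.ge_const p (m : k)

theorem ge_pow (hK : IsFunctionField k v genus) {p : Point} {a : ℤ} {f : K}
    (hf : ge v p a f) (m : ℕ) : ge v p (m * a) (f ^ m) := by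
  induction m with
  | zero => simpa using hK.ge_one p
  | succ m ih =>
    rw [pow_succ]
    have := hK.ge_mul ih hf
    convert this using 1; push_cast; ring

theorem ge_sum (hK : IsFunctionField k v genus) {p : Point} {a : ℤ} {ι : Type*} (s : Finset ι)
    (f : ι → K) (hf : ∀ i ∈ s, ge v p a (f i)) : ge v p a (∑ i ∈ s, f i) := by
  induction s using Finset.induction_on with
  | empty => simp [ge]
  | insert i s hi ih =>
    rw [Finset.sum_insert hi]
    exact hK.ge_add (hf i (Finset.mem_insert_self _ _))
      (ih fun j hj => hf j (Finset.mem_insert_of_mem hj))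

theorem ge_prod (hK : IsFunctionField k v genus) {p : Point} {ι : Type*} (s : Finset ι)
    (a : ι → ℤ) (f : ι → K) (hf : ∀ i ∈ s, ge v p (a i) (f i)) :
    ge v p (∑ i ∈ s, a i) (∏ i ∈ s, f i) := by
  induction s using Finset.induction_on with
  | empty => simpa using hK.ge_one p
  | insert i s hi ih =>
    rw [Finset.prod_insert hi, Finset.sum_insert hi]
    exact hK.ge_mul (hf i (Finset.mem_insert_self _ _))
      (ih fun j hj => hf j (Finset.mem_insert_of_mem hj))

theorem ge_iff (_hK : IsFunctionField k v genus) {p : Point} {a : ℤ} {f : K} (hf : f ≠ 0) :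
    ge v p a f ↔ a ≤ v p f := by simp [ge, hf]

theorem eq_zero_of_ge_all (hK : IsFunctionField k v genus) {p : Point} {f : K}
    (h : ∀ a, ge v p a f) : f = 0 := by
  by_contra hf
  have := (hK.ge_iff hf).1 (h (v p f + 1))
  omega

/-- cancel a factor -/
theorem ge_of_mul (hK : IsFunctionField k v genus) {p : Point} {a : ℤ} {f g : K} (hg : g ≠ 0)
    (h : ge v p (a + v p g) (f * g)) : ge v p a f := by
  by_cases hf : f = 0
  · exact Or.inl hf
  rw [hK.ge_iff (mul_ne_zero hf hg), hK.v_mul p _ _ hf hg] at h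
  exact Or.inr (by omega)

theorem ge_distinct (hK : IsFunctionField k v genus) {p : Point} {a : ℤ} {ι : Type*} (s : Finset ι)
    (f : ι → K) (hd : ∀ i ∈ s, ∀ j ∈ s, f i ≠ 0 → f j ≠ 0 → v p (f i) = v p (f j) → i = j)
    (h : ge v p a (∑ i ∈ s, f i)) : ∀ i ∈ s, ge v p a (f i) := by
  by_contra! hcon
  obtain ⟨i0, hi0, h0⟩ := hcon
  have hne : (s.filter fun i => f i ≠ 0).Nonempty :=
    ⟨i0, Finset.mem_filter.2 ⟨hi0, fun hh => h0 (Or.inl hh)⟩⟩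
  obtain ⟨i, hi, hmin⟩ := Finset.exists_min_image _ (fun i => v p (f i)) hne
  rw [Finset.mem_filter] at hi
  have hlt : v p (f i) < a := by
    have h1 := hmin i0 (Finset.mem_filter.2 ⟨hi0, fun hh => h0 (Or.inl hh)⟩)
    by_contra hh
    exact h0 (Or.inr (by omega))
  have h2 : ge v p (v p (f i) + 1) (∑ j ∈ s.erase i, f j) := by
    apply hK.ge_sum
    intro j hj
    rw [Finset.mem_erase] at hj
    by_cases hj0 : f j = 0
    · exact Or.inl hj0
    have h3 := hmin j (Finset.mem_filter.2 ⟨hj.2, hj0⟩)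
    have h4 : v p (f i) ≠ v p (f j) := fun hh => hj.1 (hd i hi.1 j hj.2 hi.2 hj0 hh).symm
    exact Or.inr (by omega)
  have h3 : f i = ∑ j ∈ s, f j - ∑ j ∈ s.erase i, f j := by
    rw [← Finset.add_sum_erase s f hi.1]; ring
  have h4 : ge v p (v p (f i) + 1) (f i) := by
    conv_rhs => rw [h3]
    exact hK.ge_sub (hK.ge_mono (by omega) h) h2
  rw [hK.ge_iff hi.2] at h4
  omega

/-- degree of a divisor -/
def dg (D : Point →₀ ℤ) : ℤ := D.sum fun _ d => d

theorem dg_add (D E : Point →₀ ℤ) : dg (D + E) = dg D + dg E :=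
  Finsupp.sum_add_index' (fun _ => rfl) (fun _ _ _ => rfl)

theorem dg_single (p : Point) (a : ℤ) : dg (Finsupp.single p a) = a :=
  Finsupp.sum_single_index rfl

/-- Riemann--Roch space -/
def LS (hK : IsFunctionField k v genus) (D : Point →₀ ℤ) : Submodule k K where
  carrier := {f | ∀ p, ge v p (-(D p)) f}
  add_mem' hf hg p := hK.ge_add (hf p) (hg p)
  zero_mem' p := hK.ge_zero p _
  smul_mem' c _ hf p := hK.ge_smul c (hf p)

theorem mem_LS (hK : IsFunctionField k v genus) {D : Point →₀ ℤ} {f : K} :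
    f ∈ hK.LS D ↔ ∀ p, ge v p (-(D p)) f := Iff.rfl

theorem finrank_LS (hK : IsFunctionField k v genus) (D : Point →₀ ℤ)
    (h : 2 * (genus : ℤ) - 2 < dg D) :
    (Module.finrank k (hK.LS D) : ℤ) = dg D + 1 - genus := by
  rw [dg, ← hK.riemann_roch D h]
  have : Submodule.span k {f : K | f = 0 ∨ ∀ p : Point, -(D p) ≤ v p f} = hK.LS D := by
    have h2 : {f : K | f = 0 ∨ ∀ p : Point, -(D p) ≤ v p f} = (hK.LS D : Set K) := by
      ext f
      simp only [Set.mem_ofPred_eq, SetLike.mem_coe, mem_LS, ge]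
      by_cases hf : f = 0 <;> simp [hf]
    rw [h2, Submodule.span_eq]
  rw [this]

theorem finite_LS (hK : IsFunctionField k v genus) (D : Point →₀ ℤ)
    (h : 2 * (genus : ℤ) - 1 < dg D) : Module.Finite k (hK.LS D) := by
  apply Module.finite_of_finrank_pos
  have := hK.finrank_LS D (by omega)
  omega

theorem LS_sub_le (hK : IsFunctionField k v genus) (D : Point →₀ ℤ) (q : Point) :
    hK.LS (D - Finsupp.single q 1) ≤ hK.LS D := by
  intro f hf p
  refine hK.ge_mono ?_ (hf p)
  rw [Finsupp.sub_apply, Finsupp.single_apply]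
  split_ifs <;> omega

theorem dg_sub_single (D : Point →₀ ℤ) (q : Point) :
    dg (D - Finsupp.single q 1) = dg D - 1 := by
  have := dg_add (D - Finsupp.single q 1) (Finsupp.single q 1)
  rw [sub_add_cancel, dg_single] at this
  omega

theorem exists_exact (hK : IsFunctionField k v genus) (D : Point →₀ ℤ) (q : Point)
    (h : 2 * (genus : ℤ) - 1 < dg D) : ∃ f ∈ hK.LS D, f ≠ 0 ∧ v q f = -(D q) := by
  have h1 := hK.finrank_LS D (by omega)
  have h2 := hK.finrank_LS (D - Finsupp.single q 1) (by rw [dg_sub_single]; omega)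
  rw [dg_sub_single] at h2
  have h3 : ¬ hK.LS D ≤ hK.LS (D - Finsupp.single q 1) := by
    intro hle
    rw [le_antisymm hle (hK.LS_sub_le D q)] at h1
    omega
  obtain ⟨f, hf, hf'⟩ := Set.not_subset.1 h3
  refine ⟨f, hf, ?_⟩
  rw [SetLike.mem_coe, mem_LS] at hf hf'
  push Not at hf'
  obtain ⟨p, hp⟩ := hf'
  have hf0 : f ≠ 0 := fun hh => hp (Or.inl hh)
  refine ⟨hf0, ?_⟩
  have h4 := (hK.ge_iff hf0).1 (hf p)
  rw [hK.ge_iff hf0, Finsupp.sub_apply, Finsupp.single_apply] at hp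
  split_ifs at hp with hpq
  · subst hpq; omega
  · omega

/-- pole divisor -/
noncomputable def pd (hK : IsFunctionField k v genus) (f : K) (hf : f ≠ 0) : Point →₀ ℤ :=
  Finsupp.ofSupportFinite (fun p => max 0 (-(v p f)))
    ((hK.finite_support f hf).subset fun p hp hh => hp (by simp [hh]))

theorem pd_apply (hK : IsFunctionField k v genus) (f : K) (hf : f ≠ 0) (p : Point) :
    hK.pd f hf p = max 0 (-(v p f)) := rfl

theorem dg_nonneg (D : Point →₀ ℤ) (h : ∀ p, 0 ≤ D p) : 0 ≤ dg D :=
  Finset.sum_nonneg fun p _ => h p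

theorem residue (hK : IsFunctionField k v genus) (q : Point) (f : K) (hf : ge v q 0 f) :
    ∃ c : k, ge v q 1 (f - algebraMap k K c) := by
  by_cases hf0 : f = 0
  · exact ⟨0, by simp [hf0, ge]⟩
  rw [hK.ge_iff hf0] at hf
  have hE0 : 0 ≤ dg (hK.pd f hf0) := dg_nonneg _ fun p => by rw [pd_apply]; exact le_max_left _ _
  have hEq : hK.pd f hf0 q = 0 := by rw [pd_apply]; omega
  set E := hK.pd f hf0 with hE
  obtain ⟨h, hh, h0, hv⟩ := hK.exists_exact (Finsupp.single q (2 * (genus : ℤ))) q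
    (by rw [dg_single]; omega)
  rw [Finsupp.single_eq_same] at hv
  set D := Finsupp.single q (2 * (genus : ℤ)) + E with hD
  have hdD : 2 * (genus : ℤ) - 1 < dg D := by rw [hD, dg_add, dg_single]; omega
  have hDq : D q = 2 * (genus : ℤ) := by rw [hD, Finsupp.add_apply, hEq]; simp
  have hx : h ∈ hK.LS D := by
    intro p
    refine hK.ge_mono ?_ (hh p)
    rw [hD, Finsupp.add_apply]
    have : 0 ≤ E p := by rw [hE, pd_apply]; exact le_max_left _ _
    omega
  have hy : f * h ∈ hK.LS D := by
    intro p
    have h1 : ge v p (-(E p)) f := by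
      rw [hK.ge_iff hf0, hE, pd_apply]; omega
    refine hK.ge_mono ?_ (hK.ge_mul h1 (hh p))
    rw [hD, Finsupp.add_apply]; omega
  have hfin := hK.finite_LS D hdD
  have h1 := hK.finrank_LS D (by omega)
  have h2 := hK.finrank_LS (D - Finsupp.single q 1) (by rw [dg_sub_single]; omega)
  rw [dg_sub_single] at h2
  set V := hK.LS (D - Finsupp.single q 1) with hV
  have hVD : V ≤ hK.LS D := hK.LS_sub_le D q
  have hxV : h ∉ V := by
    intro hh
    have := (hK.ge_iff h0).1 (hh q)
    rw [Finsupp.sub_apply, Finsupp.single_eq_same] at this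
    omega
  have hsup : V ⊔ Submodule.span k {h} ≤ hK.LS D :=
    sup_le hVD ((Submodule.span_singleton_le_iff_mem _ _).2 hx)
  have hlt : V < V ⊔ Submodule.span k {h} := by
    refine lt_of_le_of_ne le_sup_left fun hh => hxV ?_
    rw [hh]
    exact Submodule.mem_sup_right (Submodule.mem_span_singleton_self h)
  have hfin2 : Module.Finite k ↥(V ⊔ Submodule.span k {h}) := Submodule.finiteDimensional_of_le hsup
  have h3 := Submodule.finrank_lt_finrank_of_lt hlt
  have heq : V ⊔ Submodule.span k {h} = hK.LS D :=
    Submodule.eq_of_le_of_finrank_le hsup (by omega)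
  rw [← heq] at hy
  obtain ⟨y, hyV, z, hz, hyz⟩ := Submodule.mem_sup.1 hy
  obtain ⟨c, rfl⟩ := Submodule.mem_span_singleton.1 hz
  refine ⟨c, hK.ge_of_mul h0 ?_⟩
  have h5 : (f - algebraMap k K c) * h = y := by
    rw [sub_mul, ← hyz, Algebra.smul_def]; ring
  rw [h5, hv]
  refine hK.ge_mono ?_ (hyV q)
  rw [Finsupp.sub_apply, Finsupp.single_eq_same]; omega

theorem residue_unique (hK : IsFunctionField k v genus) (q : Point) (f : K) (c c' : k)
    (h : ge v q 1 (f - algebraMap k K c)) (h' : ge v q 1 (f - algebraMap k K c')) : c = c' := by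
  by_contra hne
  have h1 := hK.ge_sub h h'
  have h2 : f - algebraMap k K c - (f - algebraMap k K c') = algebraMap k K (c' - c) := by
    rw [map_sub]; ring
  have h3 : c' - c ≠ 0 := sub_ne_zero.2 (Ne.symm hne)
  rw [h2, hK.ge_iff ((map_ne_zero _).2 h3), hK.v_algebraMap q _ h3] at h1
  omega

end IsFunctionField
end basics
end FunctionFieldGCD

namespace FunctionFieldGCD
section semigroup
variable {k K Point : Type*} [Field k] [Field K] [Algebra k K] {v : Point → K → ℤ} {genus : ℕ}
namespace IsFunctionField

/-- functions regular away from `p` -/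
def Bp (hK : IsFunctionField k v genus) (p : Point) : Subalgebra k K where
  carrier := {f | ∀ q, q ≠ p → ge v q 0 f}
  add_mem' hf hg q hq := hK.ge_add (hf q hq) (hg q hq)
  mul_mem' hf hg q hq := by simpa using hK.ge_mul (hf q hq) (hg q hq)
  algebraMap_mem' c q _ := hK.ge_const q c

theorem mem_Bp (hK : IsFunctionField k v genus) {p : Point} {f : K} :
    f ∈ hK.Bp p ↔ ∀ q, q ≠ p → ge v q 0 f := Iff.rfl

theorem Bp_eq_zero (hK : IsFunctionField k v genus) {p : Point} {f : K} (hf : f ∈ hK.Bp p)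
    (h1 : ge v p 1 f) : f = 0 := by
  by_contra h0
  obtain ⟨c, hc⟩ := hK.const_of_nonneg f h0 (fun q => by
    rw [← hK.ge_iff h0]
    by_cases hq : q = p
    · subst hq; exact hK.ge_mono (by omega) h1
    · exact hf q hq)
  have hc0 : c ≠ 0 := by rintro rfl; exact h0 (by rw [← hc, map_zero])
  rw [hK.ge_iff h0, ← hc, hK.v_algebraMap p c hc0] at h1
  omega

theorem exists_order (hK : IsFunctionField k v genus) (p : Point) (m : ℕ) (hm : 2 * genus ≤ m) :
    ∃ f ∈ hK.Bp p, f ≠ 0 ∧ v p f = -(m : ℤ) := by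
  obtain ⟨f, hf, h0, h1⟩ := hK.exists_exact (Finsupp.single p (m : ℤ)) p (by rw [dg_single]; omega)
  refine ⟨f, fun q hq => ?_, h0, by rw [h1, Finsupp.single_eq_same]⟩
  have := hf q
  rwa [Finsupp.single_eq_of_ne hq, neg_zero] at this

theorem exists_apery (hK : IsFunctionField k v genus) (p : Point) (n : ℕ)
    (hn : n = 2 * genus + 1) :
    ∃ (t : K) (b : Fin n → K) (w : Fin n → ℕ),
      t ∈ hK.Bp p ∧ t ≠ 0 ∧ v p t = -(n : ℤ) ∧ (∀ i, b i ∈ hK.Bp p) ∧ (∀ i, b i ≠ 0) ∧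
      (∀ i, v p (b i) = -(w i : ℤ)) ∧ (∀ i, w i % n = i) ∧
      (∀ (m : ℕ) (f : K), f ∈ hK.Bp p → ge v p (1 - (m : ℤ)) f →
        f ∈ Submodule.span k {x | ∃ (i : Fin n) (j : ℕ), w i + n * j < m ∧ x = t ^ j * b i}) ∧
      2 * ∑ i, w i ≤ n * (2 * genus + n - 1) := by
  obtain ⟨t, ht, ht0, htv⟩ := hK.exists_order p n (by omega)
  let W : Fin n → Set ℕ := fun i => {m | m % n = i ∧ ∃ b ∈ hK.Bp p, b ≠ 0 ∧ v p b = -(m : ℤ)}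
  have hW : ∀ i, (W i).Nonempty := by
    intro i
    refine ⟨i + n * (2 * genus), ?_, hK.exists_order p _ ?_⟩
    · rw [Nat.add_mul_mod_self_left, Nat.mod_eq_of_lt i.2]
    · nlinarith
  let w : Fin n → ℕ := fun i => sInf (W i)
  have hw : ∀ i, w i ∈ W i := fun i => Nat.sInf_mem (hW i)
  have hmin : ∀ i, ∀ m ∈ W i, w i ≤ m := fun i m hm => Nat.sInf_le hm
  choose hwm b hb hb0 hbv using hw
  have hspan : ∀ (m : ℕ) (f : K), f ∈ hK.Bp p → ge v p (1 - (m : ℤ)) f →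
        f ∈ Submodule.span k {x | ∃ (i : Fin n) (j : ℕ), w i + n * j < m ∧ x = t ^ j * b i} := by
    intro m
    induction m with
    | zero =>
      intro f hf h1
      rw [hK.Bp_eq_zero hf (by simpa using h1)]
      exact zero_mem _
    | succ m ih =>
      intro f hf h1
      have hmono : Submodule.span k {x | ∃ (i : Fin n) (j : ℕ), w i + n * j < m ∧ x = t ^ j * b i}
          ≤ Submodule.span k {x | ∃ (i : Fin n) (j : ℕ), w i + n * j < m + 1 ∧ x = t ^ j * b i} := by
        apply Submodule.span_mono
        rintro x ⟨i, j, hij, rfl⟩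
        exact ⟨i, j, by omega, rfl⟩
      by_cases hlt : ge v p (1 - (m : ℤ)) f
      · exact hmono (ih f hf hlt)
      have hf0 : f ≠ 0 := fun hh => hlt (Or.inl hh)
      rw [hK.ge_iff hf0] at hlt h1
      have hvf : v p f = -(m : ℤ) := by push_cast at h1; omega
      let i : Fin n := ⟨m % n, Nat.mod_lt _ (by omega)⟩
      have hwi : w i ≤ m := hmin i m ⟨rfl, f, hf, hf0, hvf⟩
      have hmod : w i ≡ m [MOD n] := hwm i
      obtain ⟨j, hj⟩ := (Nat.modEq_iff_dvd' hwi).1 hmod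
      have hmj : m = w i + n * j := by omega
      set e := t ^ j * b i with he
      have he0 : e ≠ 0 := mul_ne_zero (pow_ne_zero _ ht0) (hb0 i)
      have heB : e ∈ hK.Bp p := mul_mem (pow_mem ht j) (hb i)
      have hev : v p e = -(m : ℤ) := by
        rw [he, hK.v_mul p _ _ (pow_ne_zero _ ht0) (hb0 i), hK.v_pow p t ht0, htv, hbv, hmj]
        push_cast; ring
      obtain ⟨c, hc⟩ := hK.residue p (f / e) (Or.inr (by rw [hK.v_div p _ _ hf0 he0]; omega))
      have h2 : ge v p (1 - (m : ℤ)) (f - c • e) := by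
        have h3 : f - c • e = (f / e - algebraMap k K c) * e := by
          rw [sub_mul, div_mul_cancel₀ _ he0, Algebra.smul_def]
        rw [h3]
        refine hK.ge_mono ?_ (hK.ge_mul hc (hK.ge_self p e))
        omega
      have h4 := hmono (ih _ (sub_mem hf (Subalgebra.smul_mem _ heB c)) h2)
      have h5 : f = (f - c • e) + c • e := by ring
      rw [h5]
      exact add_mem h4 (Submodule.smul_mem _ _ (Submodule.subset_span ⟨i, j, by omega, rfl⟩))
  refine ⟨t, b, w, ht, ht0, htv, hb, hb0, hbv, hwm, hspan, ?_⟩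
  have hn0 : 0 < n := by omega
  set Q := ∑ i, w i + 1 with hQ
  have hwQ : ∀ i, w i / n ≤ Q := fun i => (Nat.div_le_self _ _).trans
    ((Finset.single_le_sum (fun i _ => Nat.zero_le (w i)) (Finset.mem_univ i)).trans (by omega))
  have hnQ : n ≤ n * Q := Nat.le_mul_of_pos_right _ (by omega)
  let T : Finset (Fin n × ℕ) := (Finset.univ : Finset (Fin n)).biUnion
    fun i => (Finset.range (Q - w i / n)).image fun j => (i, j)
  have hT : T.card ≤ ∑ i, (Q - w i / n) := by
    refine Finset.card_biUnion_le.trans (Finset.sum_le_sum fun i _ => ?_)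
    exact Finset.card_image_le.trans (by simp)
  let D : Point →₀ ℤ := Finsupp.single p ((n * Q : ℕ) - 1 : ℤ)
  have hdD : dg D = (n * Q : ℕ) - 1 := dg_single _ _
  have hle : hK.LS D ≤ Submodule.span k ((T.image fun x => t ^ x.2 * b x.1 : Finset K) : Set K) := by
    intro f hf
    have h1 : f ∈ hK.Bp p := fun q hq => by
      have := hf q
      rwa [Finsupp.single_eq_of_ne hq, neg_zero] at this
    have h2 := hf p
    rw [Finsupp.single_eq_same] at h2
    refine Submodule.span_mono ?_ (hspan (n * Q) f h1 (hK.ge_mono (by omega) h2))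
    rintro x ⟨i, j, hij, rfl⟩
    rw [Finset.mem_coe, Finset.mem_image]
    refine ⟨(i, j), ?_, rfl⟩
    simp only [T, Finset.mem_biUnion, Finset.mem_univ, true_and, Finset.mem_image,
      Finset.mem_range]
    refine ⟨i, j, ?_, rfl⟩
    have h3 : n * (w i / n) ≤ w i := Nat.mul_div_le _ _
    have h4 : n * (w i / n + j) < n * Q := by rw [mul_add]; omega
    have := Nat.lt_of_mul_lt_mul_left h4
    omega
  have h1 := hK.finrank_LS D (by rw [hdD]; push_cast; omega)
  have h2 := Submodule.finrank_mono hle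
  have h3 := (finrank_span_finset_le_card (R := k) (T.image fun x => t ^ x.2 * b x.1))
  have h4 : (T.image fun x => t ^ x.2 * b x.1).card ≤ T.card := Finset.card_image_le
  unfold Set.finrank at h3
  have h5 : (∑ i, (Q - w i / n)) + ∑ i, w i / n = n * Q := by
    rw [← Finset.sum_add_distrib, Finset.sum_congr rfl fun i _ => Nat.sub_add_cancel (hwQ i)]
    simp
  have h6 : ∑ i, w i / n ≤ genus := by
    rw [hdD] at h1
    omega
  have h7 : ∑ i, w i = n * ∑ i, w i / n + ∑ i : Fin n, (i : ℕ) := by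
    rw [Finset.mul_sum, ← Finset.sum_add_distrib]
    refine Finset.sum_congr rfl fun i _ => ?_
    rw [← hwm i, Nat.div_add_mod]
  have h8 : (∑ i : Fin n, (i : ℕ)) * 2 = n * (n - 1) := by
    rw [Fin.sum_univ_eq_sum_range (fun i => i), Finset.sum_range_id_mul_two]
  have h9 : n * ∑ i, w i / n ≤ n * genus := Nat.mul_le_mul_left _ h6
  calc 2 * ∑ i, w i ≤ 2 * (n * genus) + n * (n - 1) := by omega
    _ = n * (2 * genus + (n - 1)) := by ring
    _ = _ := by congr 1; omega

end IsFunctionField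
end semigroup
end FunctionFieldGCD

namespace FunctionFieldGCD
section curve
variable {k K Point : Type*} [Field k] [Field K] [Algebra k K] {v : Point → K → ℤ} {genus : ℕ}
namespace IsFunctionField
open Polynomial

theorem v_aeval (hK : IsFunctionField k v genus) (p : Point) (n : ℕ) (hn : 0 < n) (t : K)
    (ht0 : t ≠ 0) (htv : v p t = -(n : ℤ)) (P : k[X]) (hP : P ≠ 0) :
    aeval t P ≠ 0 ∧ v p (aeval t P) = -((n * P.natDegree : ℕ) : ℤ) := by
  have hterm : ∀ i, P.coeff i ≠ 0 → (P.coeff i • t ^ i ≠ 0 ∧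
      v p (P.coeff i • t ^ i) = -((n * i : ℕ) : ℤ)) := by
    intro i hi
    have h1 : algebraMap k K (P.coeff i) ≠ 0 := (_root_.map_ne_zero _).2 hi
    refine ⟨by rw [Algebra.smul_def]; exact mul_ne_zero h1 (pow_ne_zero _ ht0), ?_⟩
    rw [Algebra.smul_def, hK.v_mul p _ _ h1 (pow_ne_zero _ ht0), hK.v_algebraMap p _ hi,
      hK.v_pow p t ht0, htv]
    push_cast; ring
  have hlow : ge v p (-((n * P.natDegree : ℕ) : ℤ)) (aeval t P) := by
    rw [aeval_eq_sum_range]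
    apply hK.ge_sum
    intro i hi
    by_cases h0 : P.coeff i = 0
    · simp [h0, ge]
    rw [hK.ge_iff (hterm i h0).1, (hterm i h0).2]
    have : n * i ≤ n * P.natDegree :=
      Nat.mul_le_mul_left _ (by have := Finset.mem_range.1 hi; omega)
    omega
  have hup : ¬ ge v p (-((n * P.natDegree : ℕ) : ℤ) + 1) (aeval t P) := by
    intro h
    rw [aeval_eq_sum_range] at h
    have h2 := hK.ge_distinct _ _ ?_ h P.natDegree (by simp)
    · have hl : P.coeff P.natDegree ≠ 0 := leadingCoeff_ne_zero.2 hP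
      rw [hK.ge_iff (hterm _ hl).1, (hterm _ hl).2] at h2
      omega
    · intro i _ j _ hi hj hij
      have hi' : P.coeff i ≠ 0 := fun h => hi (by simp [h])
      have hj' : P.coeff j ≠ 0 := fun h => hj (by simp [h])
      rw [(hterm i hi').2, (hterm j hj').2] at hij
      have : n * i = n * j := by omega
      exact Nat.eq_of_mul_eq_mul_left hn this
  have h0 : aeval t P ≠ 0 := fun h => hup (Or.inl h)
  refine ⟨h0, ?_⟩
  rw [hK.ge_iff h0] at hlow hup
  omega

theorem exists_denom (hK : IsFunctionField k v genus) (p q : Point) (f : K) (hf0 : f ≠ 0) :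
    ∃ b ∈ hK.Bp p, b ≠ 0 ∧ f * b ∈ hK.Bp p ∧ (q ≠ p → ge v q 0 f → v q b = 0) := by
  obtain ⟨b, hb, hb0, hbv⟩ := hK.exists_exact
    (Finsupp.single p (2 * (genus : ℤ) + dg (hK.pd f hf0)) - hK.pd f hf0) q (by
      have h1 := dg_add (Finsupp.single p (2 * (genus : ℤ) + dg (hK.pd f hf0)) - hK.pd f hf0)
        (hK.pd f hf0)
      rw [sub_add_cancel, dg_single] at h1
      omega)
  have hb' : ∀ q', q' ≠ p → ge v q' (hK.pd f hf0 q') b := by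
    intro q' hq'
    have := hb q'
    rwa [Finsupp.sub_apply, Finsupp.single_eq_of_ne hq', zero_sub, neg_neg] at this
  refine ⟨b, fun q' hq' => ?_, hb0, fun q' hq' => ?_, fun hq hf => ?_⟩
  · refine hK.ge_mono ?_ (hb' q' hq')
    rw [pd_apply]; exact le_max_left _ _
  · have h1 : ge v q' (-(hK.pd f hf0 q')) f := by
      rw [hK.ge_iff hf0, pd_apply]; omega
    simpa using hK.ge_mul h1 (hb' q' hq')
  · rw [hbv, Finsupp.sub_apply, Finsupp.single_eq_of_ne hq, pd_apply]
    rw [hK.ge_iff hf0] at hf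
    omega

theorem exists_curve_data [CharZero k] (hK : IsFunctionField k v genus) (p : Point) (n : ℕ)
    (hn : n = 2 * genus + 1) :
    ∃ (t : K) (b : Fin n → K), t ∈ hK.Bp p ∧ t ≠ 0 ∧ v p t = -(n : ℤ) ∧ (∀ i, b i ∈ hK.Bp p) ∧
      (∀ f ∈ hK.Bp p, ∃ P : Fin n → k[X], f = ∑ i, aeval t (P i) * b i) ∧
      (∃ D : Derivation k K K, D t = 1) ∧
      (∀ (T : Finset Point) (c : Point → k),
        (∀ q ∈ T, q ≠ p ∧ 1 ≤ v q (t - algebraMap k K (c q))) →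
        ∑ q ∈ T, (v q (t - algebraMap k K (c q)) - 1) ≤ 2 * (genus : ℤ) + n - 1) := by
  obtain ⟨t, b, w, ht, ht0, htv, hb, hb0, hbv, hwm, hspan, hsum⟩ := hK.exists_apery p n hn
  have hn0 : 0 < n := by omega
  have hgen : ∀ f ∈ hK.Bp p, ∃ P : Fin n → k[X], f = ∑ i, aeval t (P i) * b i := by
    intro f hf
    have h1 := hspan (1 - v p f).toNat f hf (Or.inr (by omega))
    generalize (1 - v p f).toNat = m at h1
    clear hf
    induction h1 using Submodule.span_induction with
    | mem x hx =>
      obtain ⟨i, j, -, rfl⟩ := hx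
      refine ⟨fun l => if l = i then X ^ j else 0, ?_⟩
      rw [Finset.sum_eq_single i]
      · simp
      · intro l _ hl; simp [hl]
      · simp
    | zero => exact ⟨0, by simp⟩
    | add x y _ _ hx hy =>
      obtain ⟨P, rfl⟩ := hx
      obtain ⟨Q, rfl⟩ := hy
      exact ⟨P + Q, by simp [add_mul, Finset.sum_add_distrib]⟩
    | smul a x _ hx =>
      obtain ⟨P, rfl⟩ := hx
      exact ⟨a • P, by simp [Finset.smul_sum]⟩
  have hval : ∀ (P : k[X]) (i : Fin n), P ≠ 0 → aeval t P * b i ≠ 0 ∧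
      v p (aeval t P * b i) = -((n * P.natDegree + w i : ℕ) : ℤ) := by
    intro P i hP
    obtain ⟨h1, h2⟩ := hK.v_aeval p n hn0 t ht0 htv P hP
    refine ⟨mul_ne_zero h1 (hb0 i), ?_⟩
    rw [hK.v_mul p _ _ h1 (hb0 i), h2, hbv]; push_cast; ring
  have hrepr : ∀ (P : Fin n → k[X]) (a : ℤ), ge v p a (∑ i, aeval t (P i) * b i) →
      ∀ i, ge v p a (aeval t (P i) * b i) := by
    intro P a h i
    refine hK.ge_distinct _ _ ?_ h i (Finset.mem_univ _)
    intro i _ j _ hi hj hij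
    have hi' : P i ≠ 0 := by rintro h; simp [h] at hi
    have hj' : P j ≠ 0 := by rintro h; simp [h] at hj
    rw [(hval _ i hi').2, (hval _ j hj').2] at hij
    have h1 : n * (P i).natDegree + w i = n * (P j).natDegree + w j := by omega
    have h2 := congrArg (· % n) h1
    simp only [Nat.mul_add_mod, hwm] at h2
    exact Fin.ext h2
  let A : Algebra k[X] (hK.Bp p) := (aeval (⟨t, ht⟩ : hK.Bp p)).toRingHom.toAlgebra
  have hA : ∀ P : k[X], ((algebraMap k[X] (hK.Bp p) P : hK.Bp p) : K) = aeval t P := by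
    intro P
    change ((aeval (⟨t, ht⟩ : hK.Bp p) P : hK.Bp p) : K) = _
    exact (Polynomial.aeval_algHom_apply (hK.Bp p).val (⟨t, ht⟩ : hK.Bp p) P).symm
  let bB : Fin n → hK.Bp p := fun i => ⟨b i, hb i⟩
  have hcoe : ∀ P : Fin n → k[X], ((∑ i, P i • bB i : hK.Bp p) : K) = ∑ i, aeval t (P i) * b i := by
    intro P
    rw [AddSubmonoidClass.coe_finsetSum]
    refine Finset.sum_congr rfl fun i _ => ?_
    rw [Algebra.smul_def, Subalgebra.coe_mul, hA]
  have hli : LinearIndependent k[X] bB := by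
    rw [Fintype.linearIndependent_iff]
    intro P hP i
    by_contra h0
    have h1 := congrArg (fun x : hK.Bp p => (x : K)) hP
    simp only [hcoe, ZeroMemClass.coe_zero] at h1
    exact (hval _ i h0).1 (hK.eq_zero_of_ge_all fun a => hrepr P a (Or.inl h1) i)
  have hsp : ⊤ ≤ Submodule.span k[X] (Set.range bB) := by
    rintro ⟨f, hf⟩ -
    obtain ⟨P, hP⟩ := hgen f hf
    have : (⟨f, hf⟩ : hK.Bp p) = ∑ i, P i • bB i := Subtype.ext (by rw [hcoe]; exact hP)
    rw [this]
    exact sum_mem fun i _ => Submodule.smul_mem _ _ (Submodule.subset_span ⟨i, rfl⟩)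
  let β : Module.Basis (Fin n) k[X] (hK.Bp p) := Module.Basis.mk hli hsp
  have hβ : ∀ i, β i = bB i := fun i => by simp [β]
  refine ⟨t, b, ht, ht0, htv, hb, hgen, ?_, ?_⟩
  · let A2 : Algebra k[X] K := (aeval t).toRingHom.toAlgebra
    have hA2 : ∀ P : k[X], algebraMap k[X] K P = aeval t P := fun P => rfl
    have htow : IsScalarTower k k[X] K := IsScalarTower.of_algebraMap_eq fun c => by
      rw [hA2]; simp
    have htow2 : IsScalarTower k[X] (hK.Bp p) K := IsScalarTower.of_algebraMap_eq fun P => by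
      rw [hA2, ← hA]; rfl
    have hfin : Module.Finite k[X] (hK.Bp p) := Module.Finite.of_basis β
    have hinj : Function.Injective (algebraMap k[X] K) := by
      rw [injective_iff_map_eq_zero]
      intro P hP
      by_contra h0
      exact (hK.v_aeval p n hn0 t ht0 htv P h0).1 hP
    have hint : ∀ x ∈ hK.Bp p, IsAlgebraic k[X] x := by
      intro x hx
      have h1 : IsIntegral k[X] (⟨x, hx⟩ : hK.Bp p) := Algebra.IsIntegral.isIntegral _
      have h2 : IsIntegral k[X] x := IsIntegral.map (IsScalarTower.toAlgHom k[X] (hK.Bp p) K) h1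
      exact h2.isAlgebraic
    have halg : Algebra.IsAlgebraic k[X] K := ⟨fun f => by
      by_cases hf0 : f = 0
      · subst hf0; exact isAlgebraic_zero
      obtain ⟨d, hd, hd0, hfd, -⟩ := hK.exists_denom p p f hf0
      have : f = (f * d) * d⁻¹ := by field_simp
      rw [this]
      exact (hint _ hfd).mul (hint _ hd).inv⟩
    obtain ⟨D, hD⟩ := exists_deriv_aux k K hinj
    refine ⟨D, ?_⟩
    rw [hA2, aeval_X] at hD
    exact hD
  · intro T c hT
    have htc : ∀ a : k, t - algebraMap k K a ≠ 0 ∧ v p (t - algebraMap k K a) = -(n : ℤ) := by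
      intro a
      have := hK.v_aeval p n hn0 t ht0 htv (X - C a) (X_sub_C_ne_zero a)
      simpa using this
    have htcB : ∀ a : k, t - algebraMap k K a ∈ hK.Bp p := fun a =>
      sub_mem ht (Subalgebra.algebraMap_mem _ a)
    have hZf : ∀ a : k, {q | v q (t - algebraMap k K a) ≠ 0}.Finite :=
      fun a => hK.finite_support _ (htc a).1
    let Z : k → Finset Point := fun a => (hZf a).toFinset.erase p
    have hZ : ∀ a q, q ∈ Z a ↔ q ≠ p ∧ 1 ≤ v q (t - algebraMap k K a) := by
      intro a q
      simp only [Z, Finset.mem_erase, Set.Finite.mem_toFinset, Set.mem_ofPred_eq]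
      refine and_congr_right fun hq => ?_
      have := (hK.ge_iff (htc a).1).1 (htcB a q hq)
      omega
    have hZsum : ∀ a, ∑ q ∈ Z a, v q (t - algebraMap k K a) = n := by
      intro a
      have h1 := hK.sum_v _ (htc a).1
      rw [finsum_eq_sum_of_support_subset (s := (hZf a).toFinset) _ (by
        intro q hq; simpa using hq)] at h1
      rw [← Finset.add_sum_erase _ _ (a := p) (by simp [(htc a).2]; omega)] at h1
      rw [(htc a).2] at h1
      simp only [Z]
      omega
    have hres : ∀ q i, ∃ ρ : k, q ≠ p → ge v q 1 (b i - algebraMap k K ρ) := by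
      intro q i
      by_cases hq : q = p
      · exact ⟨0, fun h => absurd hq h⟩
      · obtain ⟨ρ, hρ⟩ := hK.residue q (b i) (hb i q hq)
        exact ⟨ρ, fun _ => hρ⟩
    choose ρ hρ using hres
    let M : (a : k) → Matrix (Z a) (Fin n) k := fun a => Matrix.of fun q i => ρ q i
    let U : k → Submodule k (Fin n → k) := fun a => LinearMap.ker (M a).mulVecLin
    have hUr : ∀ a, (n : ℤ) - (Z a).card ≤ Module.finrank k (U a) := by
      intro a
      have h1 := LinearMap.finrank_range_add_finrank_ker (M a).mulVecLin
      have h2 := Submodule.finrank_le (LinearMap.range (M a).mulVecLin)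
      simp only [Module.finrank_fintype_fun_eq_card, Fintype.card_fin, Fintype.card_coe] at h1 h2
      change _ ≤ ((Module.finrank k (LinearMap.ker (M a).mulVecLin) : ℕ) : ℤ)
      omega
    have hUg : ∀ a, ∀ x ∈ U a, ∀ q ∈ Z a,
        ge v q 1 (∑ i, algebraMap k K (x i) * b i) := by
      intro a x hx q hq
      have h1 : (∑ i, ρ q i * x i) = 0 := congrFun (LinearMap.mem_ker.1 hx) ⟨q, hq⟩
      have h2 : ∑ i, algebraMap k K (x i) * b i
          = ∑ i, algebraMap k K (x i) * (b i - algebraMap k K (ρ q i)) := by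
        have h3 : ∑ i, algebraMap k K (x i) * algebraMap k K (ρ q i) = 0 := by
          rw [← map_zero (algebraMap k K), ← h1, map_sum]
          refine Finset.sum_congr rfl fun i _ => ?_
          rw [map_mul, mul_comm]
        simp only [mul_sub, Finset.sum_sub_distrib, h3, sub_zero]
      rw [h2]
      apply hK.ge_sum
      intro i _
      simpa using hK.ge_mul (hK.ge_const q (x i)) (hρ q i ((hZ a q).1 hq).1)
    have hmain := disc_bound β w ?_ (T.image c) U ?_
    · have h1 : ∑ a ∈ T.image c, Module.finrank k (U a) ≤ 2 * genus + n - 1 :=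
        Nat.le_of_mul_le_mul_left (hmain.trans hsum) hn0
      have h2 : ∑ q ∈ T, (v q (t - algebraMap k K (c q)) - 1)
          ≤ ∑ a ∈ T.image c, (Module.finrank k (U a) : ℤ) := by
        rw [← Finset.sum_fiberwise_of_maps_to (t := T.image c) (g := c)
          (fun q hq => Finset.mem_image_of_mem _ hq)]
        refine Finset.sum_le_sum fun a _ => ?_
        have h3 : ∑ q ∈ T with c q = a, (v q (t - algebraMap k K (c q)) - 1)
            ≤ ∑ q ∈ Z a, (v q (t - algebraMap k K a) - 1) := by
          calc _ = ∑ q ∈ T with c q = a, (v q (t - algebraMap k K a) - 1) := by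
                refine Finset.sum_congr rfl fun q hq => ?_
                rw [(Finset.mem_filter.1 hq).2]
            _ ≤ _ := by
                refine Finset.sum_le_sum_of_subset_of_nonneg ?_ ?_
                · intro q hq
                  obtain ⟨hq1, hq2⟩ := Finset.mem_filter.1 hq
                  rw [hZ, ← hq2]
                  exact hT q hq1
                · intro q hq _
                  have := ((hZ a q).1 hq).2
                  omega
        refine h3.trans (le_trans (le_of_eq ?_) (hUr a))
        rw [Finset.sum_sub_distrib, hZsum]
        simp
      zify at h1
      have h3 : ((2 * genus + n - 1 : ℕ) : ℤ) = 2 * (genus : ℤ) + n - 1 := by omega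
      rw [h3] at h1
      exact h2.trans h1
    · intro i j l
      have h1 : ((β i * β j * β l : hK.Bp p) : K)
          = ∑ l', aeval t (β.repr (β i * β j * β l) l') * b l' := by
        rw [← hcoe]
        congr 1
        conv_lhs => rw [← β.sum_repr (β i * β j * β l)]
        simp only [hβ]
      have h2 := hrepr (fun l' => β.repr (β i * β j * β l) l') (-(w i) + -(w j) + -(w l)) (by
        rw [← h1, hβ, hβ, hβ]
        exact hK.ge_mul (hK.ge_mul (Or.inr (hbv i).ge) (Or.inr (hbv j).ge)) (Or.inr (hbv l).ge)) l
      by_cases h0 : β.repr (β i * β j * β l) l = 0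
      · rw [h0]; simp
      · have h3 := hval _ l h0
        rw [hK.ge_iff h3.1, h3.2] at h2
        omega
    · intro a _ x hx y
      have hcoe2 : (((∑ i, algebraMap k[X] (hK.Bp p) (C (x i)) * β i) * y : hK.Bp p) : K)
          = (∑ i, algebraMap k K (x i) * b i) * y := by
        rw [Subalgebra.coe_mul, AddSubmonoidClass.coe_finsetSum]
        congr 1
        refine Finset.sum_congr rfl fun i _ => ?_
        rw [Subalgebra.coe_mul, hA, hβ, aeval_C]
      set u := (∑ i, algebraMap k[X] (hK.Bp p) (C (x i)) * β i) * y with hu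
      have hug : ∀ q ∈ Z a, ge v q 1 (u : K) := by
        intro q hq
        rw [hcoe2]
        simpa using hK.ge_mul (hUg a x hx q hq) (y.2 q ((hZ a q).1 hq).1)
      have hz : (u : K) ^ n / (t - algebraMap k K a) ∈ hK.Bp p := by
        intro q hq
        by_cases hqZ : q ∈ Z a
        · apply hK.ge_of_mul (htc a).1
          rw [div_mul_cancel₀ _ (htc a).1]
          refine hK.ge_mono ?_ (hK.ge_pow (hug q hqZ) n)
          have h1 := Finset.single_le_sum (f := fun q => v q (t - algebraMap k K a))
            (fun q hq => by have := ((hZ a q).1 hq).2; omega) hqZ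
          rw [hZsum] at h1
          omega
        · apply hK.ge_of_mul (htc a).1
          rw [div_mul_cancel₀ _ (htc a).1]
          have h1 := (hK.ge_iff (htc a).1).1 (htcB a q hq)
          have h2 : v q (t - algebraMap k K a) = 0 := by
            rw [hZ] at hqZ
            by_contra h
            exact hqZ ⟨hq, by omega⟩
          rw [h2]
          simpa using hK.ge_pow (u.2 q hq) n
      refine ⟨n, ⟨_, hz⟩, Subtype.ext ?_⟩
      rw [Subalgebra.coe_mul, hA, Subalgebra.coe_pow]
      simp only [map_sub, aeval_X, aeval_C]
      rw [mul_div_cancel₀ _ (htc a).1]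

end IsFunctionField
end curve
end FunctionFieldGCD

namespace FunctionFieldGCD
section curve
variable {k K Point : Type*} [Field k] [Field K] [Algebra k K] {v : Point → K → ℤ} {genus : ℕ}
namespace IsFunctionField
open Polynomial

theorem exists_other (hK : IsFunctionField k v genus) (q : Point) : ∃ p : Point, q ≠ p := by
  by_contra! h
  obtain ⟨f, hf0, hf⟩ := hK.exists_uniformizer q
  have h1 := hK.sum_v f hf0
  rw [finsum_eq_single _ q (fun p hp => absurd (h p).symm hp), hf] at h1
  omega

theorem deriv_bdd [CharZero k] (hK : IsFunctionField k v genus) (D : Derivation k K K) (q : Point) :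
    ∃ M : ℤ, ∀ f, ge v q 0 f → ge v q M (D f) := by
  obtain ⟨p, hp⟩ := hK.exists_other q
  obtain ⟨t, b, ht, ht0, -, hb, hgen, -, -⟩ := hK.exists_curve_data p _ rfl
  obtain ⟨m, hm, hmt, hmb⟩ : ∃ m : ℤ, m ≤ 0 ∧ ge v q m (D t) ∧ ∀ i, ge v q m (D (b i)) := by
    have h0 : 0 ≤ ∑ i, |v q (D (b i))| := Finset.sum_nonneg fun i _ => abs_nonneg _
    refine ⟨-(|v q (D t)| + ∑ i, |v q (D (b i))|), ?_, Or.inr ?_, fun i => Or.inr ?_⟩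
    · have := abs_nonneg (v q (D t)); omega
    · have := neg_abs_le (v q (D t)); omega
    · have := neg_abs_le (v q (D (b i)))
      have h2 := abs_nonneg (v q (D t))
      have := Finset.single_le_sum (f := fun i => |v q (D (b i))|) (fun i _ => abs_nonneg _)
        (Finset.mem_univ i)
      omega
  have haev : ∀ P : k[X], ge v q 0 (aeval t P) := by
    intro P
    have h : aeval t P ∈ hK.Bp p := by
      have := (aeval (⟨t, ht⟩ : hK.Bp p) P).2
      rwa [← show aeval t P = ((aeval (⟨t, ht⟩ : hK.Bp p) P : hK.Bp p) : K) from
        (Polynomial.aeval_algHom_apply (hK.Bp p).val (⟨t, ht⟩ : hK.Bp p) P)] at this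
    exact h q hp
  have hB : ∀ f ∈ hK.Bp p, ge v q m (D f) := by
    intro f hf
    obtain ⟨P, rfl⟩ := hgen f hf
    rw [map_sum]
    refine hK.ge_sum _ _ fun i _ => ?_
    rw [Derivation.leibniz, Derivation.map_aeval, smul_eq_mul, smul_eq_mul, smul_eq_mul]
    apply hK.ge_add
    · simpa using hK.ge_mul (haev (P i)) (hmb i)
    · simpa using hK.ge_mul (hb i q hp) (hK.ge_mul (haev _) hmt)
  refine ⟨m, fun f hf => ?_⟩
  by_cases hf0 : f = 0
  · simp [hf0, ge]
  obtain ⟨c, hc, hc0, hfc, hv⟩ := hK.exists_denom p q f hf0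
  apply hK.ge_of_mul hc0
  rw [hv hp hf, add_zero]
  have h1 : D f * c = D (f * c) - f * D c := by
    rw [Derivation.leibniz, smul_eq_mul, smul_eq_mul]; ring
  rw [h1]
  apply hK.ge_sub (hB _ hfc)
  simpa using hK.ge_mul hf (hB c hc)

theorem deriv_int [CharZero k] (hK : IsFunctionField k v genus) (D : Derivation k K K) (q : Point)
    (x : K) (hx0 : x ≠ 0) (hx : v q x = 1) (a : ℤ) (ha : ge v q a (D x)) (f : K)
    (hf : ge v q 0 f) : ge v q a (D f) := by
  obtain ⟨M, hM⟩ := hK.deriv_bdd D q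
  have key : ∀ j : ℕ, ∀ f, ge v q 0 f → ge v q (min a (M + j)) (D f) := by
    intro j
    induction j with
    | zero => exact fun f hf => hK.ge_mono (by simp) (hM f hf)
    | succ j ih =>
      intro f hf
      obtain ⟨c, hc⟩ := hK.residue q f hf
      obtain ⟨h, hh⟩ : ∃ h, f - algebraMap k K c = h * x :=
        ⟨(f - algebraMap k K c) / x, by field_simp⟩
      rw [hh] at hc
      have hh0 : ge v q 0 h := hK.ge_of_mul hx0 (by rw [hx]; exact hc)
      have h2 : D f = h * D x + x * D h := by
        have : D f = D (f - algebraMap k K c) := by simp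
        rw [this, hh, Derivation.leibniz, smul_eq_mul, smul_eq_mul]
      rw [h2]
      apply hK.ge_add
      · refine hK.ge_mono ?_ (hK.ge_mul hh0 ha)
        rw [zero_add]; exact min_le_left _ _
      · refine hK.ge_mono ?_ (hK.ge_mul (hK.ge_self q x) (ih h hh0))
        rw [hx]; push_cast; omega
  refine hK.ge_mono ?_ (key (a - M).toNat f hf)
  omega

theorem local_deriv [CharZero k] (hK : IsFunctionField k v genus) (D : Derivation k K K) (t : K)
    (ht : D t ≠ 0) (q : Point) :
    ∃ δ : ℤ, (∀ a f, ge v q a f → ge v q (a - 1 + δ) (D f)) ∧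
      (∀ f, f ≠ 0 → v q f ≠ 0 → D f ≠ 0 ∧ v q (D f) = v q f - 1 + δ) := by
  obtain ⟨x, hx0, hx⟩ := hK.exists_uniformizer q
  have hDx : D x ≠ 0 := by
    intro h
    have hz : ∀ f, ge v q 0 f → D f = 0 := fun f hf =>
      hK.eq_zero_of_ge_all fun a => hK.deriv_int D q x hx0 hx a (Or.inl h) f hf
    apply ht
    have ht0 : t ≠ 0 := by rintro rfl; simp at ht
    by_cases h0 : 0 ≤ v q t
    · exact hz t (Or.inr h0)
    · have h1 := hz t⁻¹ (Or.inr (by rw [hK.v_inv q t ht0]; omega))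
      have h2 : D (t * t⁻¹) = 0 := by rw [mul_inv_cancel₀ ht0]; simp
      rw [Derivation.leibniz, h1, smul_zero, zero_add, smul_eq_mul] at h2
      exact (mul_eq_zero.1 h2).resolve_left (inv_ne_zero ht0)
  have hint := fun f hf => hK.deriv_int D q x hx0 hx _ (hK.ge_self q (D x)) f hf
  have hmain : ∀ f, f ≠ 0 → ∃ u w : K, u ≠ 0 ∧ v q u = 0 ∧ ge v q (v q (D x)) w ∧
      D f = ((v q f : ℤ) : K) * (x ^ (v q f - 1) * D x * u) + x ^ (v q f) * w := by
    intro f hf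
    have hxa : x ^ (v q f) ≠ 0 := zpow_ne_zero _ hx0
    have hu0 : f / x ^ (v q f) ≠ 0 := div_ne_zero hf hxa
    have hvu : v q (f / x ^ (v q f)) = 0 := by
      rw [hK.v_div q _ _ hf hxa, hK.v_zpow q x hx0, hx]; ring
    refine ⟨f / x ^ (v q f), D (f / x ^ (v q f)), hu0, hvu, hint _ (Or.inr hvu.ge), ?_⟩
    have : D f = D (x ^ (v q f) * (f / x ^ (v q f))) := by rw [mul_div_cancel₀ _ hxa]
    conv_lhs => rw [this]
    rw [Derivation.leibniz, Derivation.leibniz_zpow]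
    simp only [smul_eq_mul, zsmul_eq_mul]
    ring
  refine ⟨v q (D x), fun a f hf => ?_, fun f hf hv => ?_⟩
  · by_cases hf0 : f = 0
    · simp [hf0, ge]
    rw [hK.ge_iff hf0] at hf
    obtain ⟨u, w, hu, hvu, hw, h⟩ := hmain f hf0
    refine hK.ge_mono (b := v q f - 1 + v q (D x)) (by omega) ?_
    rw [h]
    apply hK.ge_add
    · have h1 := hK.ge_mul (hK.ge_intCast q (v q f)) (hK.ge_mul (hK.ge_mul
        (hK.ge_self q (x ^ (v q f - 1))) (hK.ge_self q (D x))) (hK.ge_self q u))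
      rw [hK.v_zpow q x hx0, hx, hvu] at h1
      exact hK.ge_mono (by omega) h1
    · have h1 := hK.ge_mul (hK.ge_self q (x ^ (v q f))) hw
      rw [hK.v_zpow q x hx0, hx] at h1
      exact hK.ge_mono (by omega) h1
  · obtain ⟨u, w, hu, hvu, hw, h⟩ := hmain f hf
    have h2 := hK.ge_mul (hK.ge_self q (x ^ (v q f))) hw
    rw [hK.v_zpow q x hx0, hx] at h2
    have hc : ((v q f : ℤ) : k) ≠ 0 := Int.cast_ne_zero.2 hv
    have hcc : ((v q f : ℤ) : K) = algebraMap k K ((v q f : ℤ) : k) := by simp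
    have hc0 : ((v q f : ℤ) : K) ≠ 0 := by rw [hcc]; exact (_root_.map_ne_zero _).2 hc
    have hx1 : x ^ (v q f - 1) ≠ 0 := zpow_ne_zero _ hx0
    set A := ((v q f : ℤ) : K) * (x ^ (v q f - 1) * D x * u) with hA
    have hA0 : A ≠ 0 := mul_ne_zero hc0 (mul_ne_zero (mul_ne_zero hx1 hDx) hu)
    have hAv : v q A = v q f - 1 + v q (D x) := by
      rw [hA, hK.v_mul q _ _ hc0 (mul_ne_zero (mul_ne_zero hx1 hDx) hu),
        hK.v_mul q _ _ (mul_ne_zero hx1 hDx) hu, hK.v_mul q _ _ hx1 hDx, hK.v_zpow q x hx0, hx, hvu,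
        hcc, hK.v_algebraMap q _ hc]
      ring
    have hup : ¬ ge v q (v q f - 1 + v q (D x) + 1) (D f) := by
      intro h3
      have h4 := hK.ge_sub h3 (hK.ge_mono (a := v q f - 1 + v q (D x) + 1) (by omega) h2)
      rw [h, add_sub_cancel_right, hK.ge_iff hA0] at h4
      omega
    have h0 : D f ≠ 0 := fun h => hup (Or.inl h)
    refine ⟨h0, ?_⟩
    have hlow : ge v q (v q f - 1 + v q (D x)) (D f) := by
      rw [h]
      exact hK.ge_add (Or.inr hAv.ge) (hK.ge_mono (by omega) h2)
    rw [hK.ge_iff h0] at hup hlow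
    omega

theorem exists_derivation [CharZero k] (hK : IsFunctionField k v genus) (p : Point) :
    ∃ (D : Derivation k K K) (δ : Point → ℤ) (T : Finset Point),
      (∀ f : K, D f = 0 → ∃ c : k, algebraMap k K c = f) ∧
      (∀ q a f, ge v q a f → ge v q (a - 1 + δ q) (D f)) ∧
      (∀ q ∉ T, δ q = 0) ∧ 2 - 2 * (genus : ℤ) ≤ ∑ q ∈ T, δ q := by
  obtain ⟨t, b, ht, ht0, htv, -, -, ⟨D, hD⟩, hram⟩ := hK.exists_curve_data p _ rfl
  choose δ h1 h2 using hK.local_deriv D t (by rw [hD]; exact one_ne_zero)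
  have hc : ∀ q, ∃ c : k, q ≠ p → ge v q 1 (t - algebraMap k K c) := by
    intro q
    by_cases hq : q = p
    · exact ⟨0, fun h => absurd hq h⟩
    · obtain ⟨c, hc⟩ := hK.residue q t (ht q hq)
      exact ⟨c, fun _ => hc⟩
  choose c hc using hc
  have hD' : ∀ c : k, D (t - algebraMap k K c) = 1 := by intro c; simp [hD]
  have hne : ∀ c : k, t - algebraMap k K c ≠ 0 := by
    intro c h
    have := hD' c
    rw [h] at this
    simp at this
  have hδp : δ p = 2 * genus + 2 := by
    have := (h2 p t ht0 (by rw [htv]; omega)).2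
    rw [hD, hK.v_one, htv] at this
    push_cast at this
    omega
  have he : ∀ q, q ≠ p → 1 ≤ v q (t - algebraMap k K (c q)) ∧
      v q (t - algebraMap k K (c q)) - 1 = - δ q := by
    intro q hq
    have h3 := (hK.ge_iff (hne _)).1 (hc q hq)
    refine ⟨h3, ?_⟩
    have := (h2 q _ (hne (c q)) (by omega)).2
    rw [hD', hK.v_one] at this
    omega
  have hbd : ∀ T : Finset Point, p ∉ T → ∑ q ∈ T, (- δ q) ≤ 4 * (genus : ℤ) := by
    intro T hT
    have hqp : ∀ q ∈ T, q ≠ p := fun q hq h => hT (h ▸ hq)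
    have := hram T c fun q hq => ⟨hqp q hq, (he q (hqp q hq)).1⟩
    rw [Finset.sum_congr rfl fun q hq => (he q (hqp q hq)).2] at this
    push_cast at this
    omega
  have hfin : {q | q ≠ p ∧ δ q ≠ 0}.Finite := by
    by_contra hinf
    obtain ⟨T, hT, hcard⟩ := Set.Infinite.exists_subset_card_eq hinf (4 * genus + 1)
    have h3 := hbd T (fun h => (hT h).1 rfl)
    have h4 : ∑ q ∈ T, (1 : ℤ) ≤ ∑ q ∈ T, (- δ q) := Finset.sum_le_sum fun q hq => by
      have h5 := hT hq
      have h6 := he q h5.1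
      have h7 := h5.2
      omega
    simp [hcard] at h4
    simp at h3
    omega
  have hp : p ∉ hfin.toFinset := by simp
  refine ⟨D, δ, insert p hfin.toFinset, fun f hf => ?_, h1, fun q hq => ?_, ?_⟩
  · by_contra hcon
    have hf0 : f ≠ 0 := by rintro rfl; exact hcon ⟨0, by simp⟩
    have : ∃ q, v q f ≠ 0 := by
      by_contra! hall
      exact hcon (hK.const_of_nonneg f hf0 fun q => (hall q).ge)
    obtain ⟨q, hq⟩ := this
    exact (h2 q f hf0 hq).1 hf
  · simp at hq
    exact hq.2 hq.1
  · rw [Finset.sum_insert hp, hδp]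
    have := hbd _ hp
    rw [Finset.sum_neg_distrib] at this
    omega

end IsFunctionField
end curve
end FunctionFieldGCD

namespace FunctionFieldGCD
section curve
variable {k K Point : Type*} [Field k] [Field K] [Algebra k K] {v : Point → K → ℤ} {genus : ℕ}

/-- Wronskian -/
noncomputable def wr (D : Derivation k K K) (m : ℕ) (f : Fin m → K) : K :=
  (Matrix.of fun i j : Fin m => (D^[(i : ℕ)]) (f j)).det

theorem iter_sum (D : Derivation k K K) (i : ℕ) {ι : Type*} (s : Finset ι) (c : ι → k)
    (f : ι → K) : (D^[i]) (∑ l ∈ s, c l • f l) = ∑ l ∈ s, c l • (D^[i]) (f l) := by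
  induction i with
  | zero => rfl
  | succ i ih =>
    rw [Function.iterate_succ_apply', ih, map_sum]
    refine Finset.sum_congr rfl fun l _ => ?_
    rw [Function.iterate_succ_apply', Derivation.map_smul]

theorem wr_change (D : Derivation k K K) (m : ℕ) (f f' : Fin m → K)
    (h : ∀ j, f' j ∈ Submodule.span k (Set.range f)) :
    ∃ c : k, wr D m f' = wr D m f * algebraMap k K c := by
  have h' : ∀ j, ∃ c : Fin m → k, ∑ i, c i • f i = f' j := fun j =>
    (Submodule.mem_span_range_iff_exists_fun k).1 (h j)
  choose A hA using h'
  refine ⟨(Matrix.of fun l j => A j l).det, ?_⟩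
  rw [RingHom.map_det, wr, wr, ← Matrix.det_mul]
  congr 1
  ext i j
  rw [Matrix.mul_apply, Matrix.of_apply, ← hA, iter_sum]
  refine Finset.sum_congr rfl fun l _ => ?_
  simp [Algebra.smul_def, mul_comm]

namespace IsFunctionField

theorem ge_iter (hK : IsFunctionField k v genus) (D : Derivation k K K) (q : Point) (δ : ℤ)
    (hD : ∀ a f, ge v q a f → ge v q (a - 1 + δ) (D f)) (i : ℕ) (a : ℤ) (f : K)
    (hf : ge v q a f) : ge v q (a - i * (1 - δ)) ((D^[i]) f) := by
  induction i with
  | zero => simpa using hf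
  | succ i ih =>
    rw [Function.iterate_succ_apply']
    refine hK.ge_mono ?_ (hD _ _ ih)
    push_cast
    linarith

theorem ge_det (hK : IsFunctionField k v genus) (q : Point) (m : ℕ) (A : Matrix (Fin m) (Fin m) K)
    (a : ℤ) (h : ∀ σ : Equiv.Perm (Fin m), ge v q a (∏ i, A (σ i) i)) : ge v q a A.det := by
  rw [Matrix.det_apply]
  refine hK.ge_sum _ _ fun σ _ => ?_
  rcases Int.units_eq_one_or (Equiv.Perm.sign σ) with h1 | h1
  · rw [h1, one_smul]; exact h σ
  · rw [h1, Units.neg_smul, one_smul]; exact hK.ge_neg (h σ)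

theorem wr_ge (hK : IsFunctionField k v genus) (D : Derivation k K K) (q : Point) (δ : ℤ)
    (hD : ∀ a f, ge v q a f → ge v q (a - 1 + δ) (D f)) (m : ℕ) (f : Fin m → K) (a : Fin m → ℤ)
    (hf : ∀ j, ge v q (a j) (f j)) :
    ge v q (∑ j, a j - (∑ i : Fin m, (i : ℤ)) * (1 - δ)) (wr D m f) := by
  apply hK.ge_det
  intro σ
  have h1 := hK.ge_prod Finset.univ (fun i => a i - ((σ i : ℕ) : ℤ) * (1 - δ))
    (fun i => (D^[(σ i : ℕ)]) (f i)) (fun i _ => hK.ge_iter D q δ hD _ _ _ (hf i))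
  rw [Finset.sum_sub_distrib, ← Finset.sum_mul,
    Equiv.sum_comp σ (fun i : Fin m => ((i : ℕ) : ℤ))] at h1
  exact h1

theorem wr_bound (hK : IsFunctionField k v genus) (D : Derivation k K K)
    (hker : ∀ f : K, D f = 0 → ∃ c : k, algebraMap k K c = f) (q : Point) (δ : ℤ)
    (hD : ∀ a f, ge v q a f → ge v q (a - 1 + δ) (D f)) (m : ℕ) (f : Fin m → K)
    (hf : LinearIndependent k f) {ι : Type*} [Fintype ι] (hι : Fintype.card ι = m)
    (f' : ι → K) (hf' : LinearIndependent k f')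
    (hsp : ∀ j, f' j ∈ Submodule.span k (Set.range f)) (a : ι → ℤ)
    (ha : ∀ j, ge v q (a j) (f' j)) :
    ∑ j, a j - (∑ i : Fin m, (i : ℤ)) * (1 - δ) ≤ v q (wr D m f) := by
  let e : Fin m ≃ ι := (Fintype.equivFinOfCardEq hι).symm
  have h0 : wr D m f ≠ 0 := wronsk_ne_zero D hker m f hf
  have h0' : wr D m (f' ∘ e) ≠ 0 := wronsk_ne_zero D hker m _ (hf'.comp e e.injective)
  obtain ⟨c, hc⟩ := wr_change D m f (f' ∘ e) (fun j => hsp _)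
  have hc0 : c ≠ 0 := by rintro rfl; simp [hc] at h0'
  have h1 := hK.wr_ge D q δ hD m (f' ∘ e) (a ∘ e) (fun j => ha _)
  rw [hK.ge_iff h0', hc, hK.v_mul q _ _ h0 ((_root_.map_ne_zero _).2 hc0),
    hK.v_algebraMap q c hc0, add_zero] at h1
  simp only [Function.comp] at h1
  rwa [Equiv.sum_comp e a] at h1

theorem echelon (hK : IsFunctionField k v genus) (q : Point) (m : ℕ) :
    ∀ (E : Submodule k K) (_ : Module.Finite k E) (a : ℤ) (_ : ∀ x ∈ E, ge v q a x)
      (_ : m ≤ Module.finrank k E), ∃ f : Fin m → K, LinearIndependent k f ∧ (∀ i, f i ∈ E) ∧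
      ∀ i : Fin m, ge v q (a + ((i : ℕ) : ℤ)) (f i) := by
  induction m with
  | zero =>
    intro E _ a _ _
    exact ⟨fun i => i.elim0, linearIndependent_empty_type, fun i => i.elim0, fun i => i.elim0⟩
  | succ m ih =>
    intro E hfin a hE hm
    let E' : Submodule k K :=
      { carrier := {x | x ∈ E ∧ ge v q (a + 1) x}
        add_mem' := fun hx hy => ⟨E.add_mem hx.1 hy.1, hK.ge_add hx.2 hy.2⟩
        zero_mem' := ⟨E.zero_mem, hK.ge_zero q _⟩
        smul_mem' := fun c x hx => ⟨E.smul_mem c hx.1, hK.ge_smul c hx.2⟩ }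
    have hE' : ∀ x, x ∈ E' ↔ x ∈ E ∧ ge v q (a + 1) x := fun x => Iff.rfl
    have hle : E' ≤ E := fun x hx => hx.1
    have hfin' : Module.Finite k E' := Submodule.finiteDimensional_of_le hle
    have hrk : Module.finrank k E ≤ Module.finrank k E' + 1 := by
      by_cases hall : ∀ x ∈ E, ge v q (a + 1) x
      · exact (Submodule.finrank_mono (fun x hx => (hE' x).2 ⟨hx, hall x hx⟩)).trans
          (Nat.le_succ _)
      · push Not at hall
        obtain ⟨x, hx, hxn⟩ := hall
        have hx0 : x ≠ 0 := fun h => hxn (Or.inl h)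
        have hxa : v q x = a := by
          have h1 := hE x hx
          rw [hK.ge_iff hx0] at hxn h1
          omega
        have hsup : E ≤ E' ⊔ Submodule.span k {x} := by
          intro y hy
          have h1 : ge v q 0 (y / x) := hK.ge_of_mul hx0 (by
            rw [div_mul_cancel₀ _ hx0, hxa, zero_add]; exact hE y hy)
          obtain ⟨c, hc⟩ := hK.residue q _ h1
          have h2 := hK.ge_mul hc (hK.ge_self q x)
          have h3 : (y / x - algebraMap k K c) * x = y - c • x := by
            rw [Algebra.smul_def]; field_simp
          rw [h3, hxa] at h2
          rw [show y = (y - c • x) + c • x by ring]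
          refine Submodule.add_mem_sup ((hE' _).2 ⟨E.sub_mem hy (E.smul_mem c hx), ?_⟩)
            (Submodule.smul_mem _ c (Submodule.mem_span_singleton_self x))
          exact hK.ge_mono (by omega) h2
        refine (Submodule.finrank_mono hsup).trans
          ((Submodule.finrank_add_le_finrank_add_finrank _ _).trans ?_)
        rw [finrank_span_singleton hx0]
    obtain ⟨f, hf, hfE, hfg⟩ := ih E' hfin' (a + 1) (fun x hx => hx.2) (by omega)
    have hspan : Submodule.span k (Set.range f) ≤ E :=
      Submodule.span_le.2 (by rintro _ ⟨i, rfl⟩; exact hle (hfE i))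
    have hex : ∃ x ∈ E, x ∉ Submodule.span k (Set.range f) := by
      by_contra! hcon
      have : Module.Finite k (Submodule.span k (Set.range f)) := Module.Finite.span_of_finite k (Set.finite_range f)
      have h1 := Submodule.finrank_mono (R := k) (show E ≤ Submodule.span k (Set.range f) from hcon)
      rw [finrank_span_eq_card hf, Fintype.card_fin] at h1
      omega
    obtain ⟨x, hx, hxn⟩ := hex
    refine ⟨Fin.cons x f, linearIndependent_finCons.2 ⟨hf, hxn⟩, fun i => ?_, fun i => ?_⟩
    · refine Fin.cases ?_ (fun i => ?_) i
      · simpa using hx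
      · simpa using hle (hfE i)
    · refine Fin.cases ?_ (fun i => ?_) i
      · simpa using hE x hx
      · have := hfg i
        simp only [Fin.cons_succ, Fin.val_succ]
        refine hK.ge_mono ?_ this
        push_cast; omega

end IsFunctionField
end curve
end FunctionFieldGCD

namespace FunctionFieldGCD
section curve
variable {k K Point : Type*} [Field k] [Field K] [Algebra k K] {v : Point → K → ℤ} {genus : ℕ}

/-- linear nondegeneracy of a finite family over a subspace -/
def NonDeg (V : Submodule k K) {μ : Type*} [Fintype μ] (G : μ → K) : Prop :=
  ∀ c : μ → K, (∀ m, c m ∈ V) → ∑ m, c m * G m = 0 → ∀ m, c m = 0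

theorem li_prod (V : Submodule k K) {μ κ : Type*} [Fintype μ] [Fintype κ] (G : μ → K)
    (hH : NonDeg V G) (γ : κ → K) (hγ : LinearIndependent k γ) (hγV : ∀ s, γ s ∈ V) :
    LinearIndependent k (fun x : μ × κ => γ x.2 * G x.1) := by
  rw [Fintype.linearIndependent_iff]
  intro c hc
  have h1 := hH (fun m => ∑ s, c (m, s) • γ s)
    (fun m => V.sum_mem fun s _ => V.smul_mem _ (hγV s)) (by
      rw [← hc, Fintype.sum_prod_type]
      refine Finset.sum_congr rfl fun m _ => ?_
      rw [Finset.sum_mul]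
      exact Finset.sum_congr rfl fun s _ => by rw [smul_mul_assoc])
  rintro ⟨m, s⟩
  exact (Fintype.linearIndependent_iff.1 hγ) _ (h1 m) s

theorem li_prod' (V : Submodule k K) {μ κ κ' : Type*} [Fintype μ] [Fintype κ] [Fintype κ']
    (G : μ → K) (hH : NonDeg V G) (γ : κ ⊕ κ' → K) (hγ : LinearIndependent k γ)
    (hγV : ∀ s, γ s ∈ V) (m0 : μ) (a : μ → K) (u : κ → K) (hu : ∀ m i, a m * u i ∈ V)
    (hγu : ∀ i, γ (Sum.inl i) = a m0 * u i) (f : μ × (κ ⊕ κ') → K)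
    (hf1 : ∀ m s, m ≠ m0 → f (m, s) = γ s * G m)
    (hf2 : ∀ s, f (m0, Sum.inr s) = γ (Sum.inr s) * G m0)
    (hf3 : ∀ i, f (m0, Sum.inl i) = u i * ∑ m, a m * G m) :
    LinearIndependent k f := by
  rw [Fintype.linearIndependent_iff]
  intro c hc
  let R : μ → K := fun m => if m = m0 then 0 else ∑ i, c (m0, Sum.inl i) • (a m * u i)
  have hRV : ∀ m, R m ∈ V := by
    intro m
    simp only [R]
    split_ifs
    · exact V.zero_mem
    · exact V.sum_mem fun i _ => V.smul_mem _ (hu m i)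
  have hsum : ∑ m, (∑ s, c (m, s) • γ s + R m) * G m = 0 := by
    have e1 : ∀ m, ∑ s, c (m, s) • f (m, s) = (∑ s, c (m, s) • γ s) * G m +
        (if m = m0 then ∑ m', R m' * G m' else 0) := by
      intro m
      by_cases hm : m = m0
      · subst hm
        rw [if_pos rfl, Fintype.sum_sum_type, Fintype.sum_sum_type]
        have e2 : ∀ i, c (m, Sum.inl i) • f (m, Sum.inl i) =
            (c (m, Sum.inl i) • γ (Sum.inl i)) * G m +
              ∑ m', (if m' = m then 0 else c (m, Sum.inl i) • (a m' * u i)) * G m' := by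
          intro i
          rw [hf3, hγu, Finset.mul_sum, Finset.smul_sum,
            ← Finset.add_sum_erase _ _ (Finset.mem_univ m),
            ← Finset.add_sum_erase _ (fun m' => (if m' = m then 0 else
              c (m, Sum.inl i) • (a m' * u i)) * G m') (Finset.mem_univ m)]
          rw [if_pos rfl, zero_mul, zero_add]
          congr 1
          · rw [Algebra.smul_def, Algebra.smul_def]; ring
          · refine Finset.sum_congr rfl fun m' hm' => ?_
            rw [if_neg (Finset.ne_of_mem_erase hm'), Algebra.smul_def, Algebra.smul_def]; ring
        rw [Finset.sum_congr rfl fun i _ => e2 i, Finset.sum_add_distrib, Finset.sum_comm]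
        have e3 : ∀ m', ∑ i, (if m' = m then 0 else c (m, Sum.inl i) • (a m' * u i)) * G m'
            = R m' * G m' := by
          intro m'
          rw [← Finset.sum_mul]
          simp only [R]
          split_ifs <;> simp
        rw [Finset.sum_congr rfl fun m' _ => e3 m']
        simp only [hf2, add_mul, Finset.sum_mul, smul_mul_assoc]
        ring
      · rw [if_neg hm, add_zero, Finset.sum_mul]
        exact Finset.sum_congr rfl fun s _ => by rw [hf1 m s hm, smul_mul_assoc]
    rw [Fintype.sum_prod_type, Finset.sum_congr rfl fun m _ => e1 m, Finset.sum_add_distrib,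
      Finset.sum_ite_eq' Finset.univ m0] at hc
    simp only [Finset.mem_univ, if_true] at hc
    rw [← Finset.sum_add_distrib] at hc
    rw [← hc]
    exact Finset.sum_congr rfl fun m _ => by ring
  have h1 := hH _ (fun m => V.add_mem (V.sum_mem fun s _ => V.smul_mem _ (hγV s)) (hRV m)) hsum
  have h0 : ∀ s, c (m0, s) = 0 := by
    have h2 := h1 m0
    simp only [R, if_true, add_zero] at h2
    exact (Fintype.linearIndependent_iff.1 hγ) _ h2
  rintro ⟨m, s⟩
  have h2 := h1 m
  have hR0 : R m = 0 := by simp [R, h0]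
  rw [hR0, add_zero] at h2
  exact (Fintype.linearIndependent_iff.1 hγ) _ h2 s

theorem sum_calc {μ : Type*} [Fintype μ] {n e : ℕ} (ρ : ℤ) (G : μ → ℤ) (m0 : μ) (x : ℤ) :
    ∑ z : μ × (Fin n ⊕ Fin e), (ρ + G z.1 + if z.1 = m0 then Sum.elim (fun _ => x)
      (fun _ => 0) z.2 else 0) =
    (Fintype.card μ : ℤ) * (n + e) * ρ + (n + e) * ∑ m, G m + n * x := by
  rw [Fintype.sum_prod_type]
  have h : ∀ m, ∑ s : Fin n ⊕ Fin e, (ρ + G m + if m = m0 then Sum.elim (fun _ => x)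
      (fun _ => 0) s else 0) = (n + e) * ρ + (n + e) * G m + if m = m0 then n * x else 0 := by
    intro m
    rw [Fintype.sum_sum_type]
    by_cases hm : m = m0
    · simp [hm]; ring
    · simp [hm]; ring
  rw [Finset.sum_congr rfl fun m _ => h m, Finset.sum_add_distrib, Finset.sum_add_distrib,
    ← Finset.mul_sum, ← Finset.mul_sum, Finset.sum_ite_eq' Finset.univ m0, Finset.sum_const, Finset.card_univ,
    nsmul_eq_mul, if_pos (Finset.mem_univ _)]
  ring

theorem exists_ext {V : Type*} [AddCommGroup V] [Module k V] [Module.Finite k V] {n : ℕ}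
    (w : Fin n → V) (hw : LinearIndependent k w) :
    ∃ (e : ℕ) (γ : Fin n ⊕ Fin e → V), LinearIndependent k γ ∧ (∀ i, γ (Sum.inl i) = w i) ∧
      Fintype.card (Fin n ⊕ Fin e) = Module.finrank k V := by
  obtain ⟨Q, hQ⟩ := (Submodule.span k (Set.range w)).exists_isCompl
  have h1 := Submodule.finrank_add_eq_of_isCompl hQ
  rw [finrank_span_eq_card hw, Fintype.card_fin] at h1
  let b := Module.finBasis k Q
  have hb : LinearIndependent k (fun i => (b i : V)) :=
    b.linearIndependent.map' Q.subtype (Submodule.ker_subtype Q)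
  refine ⟨Module.finrank k Q, Sum.elim w (fun i => (b i : V)), hw.sum_type hb ?_, fun i => rfl, ?_⟩
  · refine hQ.disjoint.mono_right (Submodule.span_le.2 ?_)
    rintro _ ⟨i, rfl⟩
    exact (b i).2
  · rw [Fintype.card_sum, Fintype.card_fin, Fintype.card_fin, h1]

namespace IsFunctionField

set_option maxHeartbeats 1600000 in
theorem core_loc (hK : IsFunctionField k v genus) (D : Derivation k K K)
    (hker : ∀ f : K, D f = 0 → ∃ c : k, algebraMap k K c = f)
    {μ : Type*} [Fintype μ] (V U : Submodule k K) [Module.Finite k V] (hUV : U ≤ V)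
    (G : μ → K) (hH : NonDeg V G) (hG0 : ∀ m, G m ≠ 0) (m0 : μ) (hm0 : G m0 = 1)
    (a : μ → K) (ha0 : a m0 ≠ 0) (haU : ∀ m, ∀ u ∈ U, a m * u ∈ V)
    (M : ℕ) (hM : M = Fintype.card μ * Module.finrank k V) :
    ∃ W : K, W ≠ 0 ∧
      (∀ q δ ρ, (∀ b f, ge v q b f → ge v q (b - 1 + δ) (D f)) → (∀ x ∈ V, ge v q ρ x) →
        (M : ℤ) * ρ + Module.finrank k V * ∑ m, v q (G m)
          + Module.finrank k U * v0 v q (∑ m, a m * G m)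
          - (∑ i : Fin M, (i : ℤ)) * (1 - δ) ≤ v q W) ∧
      (∀ q δ ρ, (∀ b f, ge v q b f → ge v q (b - 1 + δ) (D f)) → (∀ x ∈ V, ge v q ρ x) →
        (∀ m, v q (G m) = 0) →
        (M : ℤ) * ρ + (∑ i : Fin M, (i : ℤ)) * δ ≤ v q W) := by
  have hUfin : Module.Finite k U := Submodule.finiteDimensional_of_le hUV
  let β := Module.finBasis k V
  have hβ : LinearIndependent k (fun i => (β i : K)) :=
    β.linearIndependent.map' V.subtype (Submodule.ker_subtype V)
  let f0 : μ × Fin (Module.finrank k V) → K := fun x => (β x.2 : K) * G x.1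
  have hf0 : LinearIndependent k f0 := li_prod V G hH _ hβ (fun i => (β i).2)
  have hcard : Fintype.card (μ × Fin (Module.finrank k V)) = M := by
    rw [Fintype.card_prod, Fintype.card_fin, hM]
  let e : Fin M ≃ μ × Fin (Module.finrank k V) := (Fintype.equivFinOfCardEq hcard).symm
  have hf : LinearIndependent k (f0 ∘ e) := hf0.comp e e.injective
  have hrange : Set.range (f0 ∘ e) = Set.range f0 := e.surjective.range_comp f0
  have hmemE : ∀ x ∈ V, ∀ m, x * G m ∈ Submodule.span k (Set.range (f0 ∘ e)) := by
    intro x hx m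
    rw [hrange]
    have h1 := β.sum_repr ⟨x, hx⟩
    have h2 := congrArg (V.subtype) h1
    rw [map_sum] at h2
    simp only [map_smul, Submodule.subtype_apply] at h2
    rw [← h2, Finset.sum_mul]
    refine Submodule.sum_mem _ fun i _ => ?_
    rw [smul_mul_assoc]
    exact Submodule.smul_mem _ _ (Submodule.subset_span ⟨(m, i), rfl⟩)
  refine ⟨wr D M (f0 ∘ e), wronsk_ne_zero D hker M _ hf, ?_, ?_⟩
  · intro q δ ρ hD hρ
    by_cases hv : v q (∑ m, a m * G m) ≤ 0
    · have h1 := hK.wr_bound D hker q δ hD M _ hf hcard f0 hf0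
        (fun x => hmemE _ (β x.2).2 x.1) (fun x => ρ + v q (G x.1))
        (fun x => hK.ge_mul (hρ _ (β x.2).2) (hK.ge_self q _))
      rw [Finset.sum_add_distrib, Finset.sum_const, Finset.card_univ, hcard,
        Fintype.sum_prod_type] at h1
      simp only [Finset.sum_const, Finset.card_univ, Fintype.card_fin, nsmul_eq_mul] at h1
      rw [← Finset.mul_sum] at h1
      rw [v0, max_eq_left hv]
      linarith
    · let u := Module.finBasis k U
      let w : Fin (Module.finrank k U) → V := fun i => ⟨a m0 * u i, haU m0 _ (u i).2⟩
      have hw : LinearIndependent k w := by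
        apply LinearIndependent.of_comp V.subtype
        have h1 : LinearIndependent k (fun i => (u i : K)) :=
          u.linearIndependent.map' U.subtype (Submodule.ker_subtype U)
        have h2 := h1.map' (LinearMap.mulLeft k (a m0)) (by
          rw [LinearMap.ker_eq_bot]
          exact mul_right_injective₀ ha0)
        exact h2
      obtain ⟨e', B, hB, hBw, hcB⟩ := exists_ext w hw
      let γ : Fin (Module.finrank k U) ⊕ Fin e' → K := fun s => (B s : K)
      have hγ : LinearIndependent k γ := hB.map' V.subtype (Submodule.ker_subtype V)
      let f' : μ × (Fin (Module.finrank k U) ⊕ Fin e') → K := fun x =>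
        if x.1 = m0 then Sum.elim (fun i => (u i : K) * ∑ m, a m * G m)
          (fun s => γ (Sum.inr s) * G m0) x.2 else γ x.2 * G x.1
      have hf' : LinearIndependent k f' := by
        refine li_prod' V G hH γ hγ (fun s => (B s).2) m0 a (fun i => (u i : K))
          (fun m i => haU m _ (u i).2) (fun i => ?_) f' ?_ ?_ ?_
        · simp only [γ, hBw, w]
        · intro m s hm; simp [f', hm]
        · intro s; simp [f']
        · intro i; simp [f']
      have hcard' : Fintype.card (μ × (Fin (Module.finrank k U) ⊕
          Fin e')) = M := by
        rw [Fintype.card_prod, hcB, hM]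
      have h1 := hK.wr_bound D hker q δ hD M _ hf hcard' f' hf' (fun x => ?_)
        (fun x => ρ + v q (G x.1) + if x.1 = m0 then Sum.elim (fun _ => v q (∑ m, a m * G m))
          (fun _ => 0) x.2 else 0) (fun x => ?_)
      · rw [sum_calc ρ (fun m => v q (G m)) m0 (v q (∑ m, a m * G m))] at h1
        rw [Fintype.card_sum, Fintype.card_fin, Fintype.card_fin] at hcB
        have hcz : (Module.finrank k U : ℤ) + e' = Module.finrank k V := by exact_mod_cast hcB
        have hMz : (M : ℤ) = Fintype.card μ * Module.finrank k V := by exact_mod_cast hM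
        rw [hcz, ← hMz] at h1
        rw [v0, max_eq_right (by omega)]
        linarith
      · obtain ⟨m, s⟩ := x
        simp only [f']
        split_ifs with hm
        · rcases s with i | s
          · simp only [Sum.elim_inl]
            rw [Finset.mul_sum]
            refine Submodule.sum_mem _ fun m' _ => ?_
            rw [show (u i : K) * (a m' * G m') = (a m' * u i) * G m' by ring]
            exact hmemE _ (haU m' _ (u i).2) m'
          · exact hmemE _ (B _).2 m0
        · exact hmemE _ (B _).2 m
      · obtain ⟨m, s⟩ := x
        simp only [f']
        split_ifs with hm
        · subst hm
          rcases s with i | s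
          · simp only [Sum.elim_inl]
            rw [hm0, hK.v_one, add_zero]
            exact hK.ge_mul (hρ _ (hUV (u i).2)) (hK.ge_self q _)
          · simp only [Sum.elim_inr, add_zero]
            exact hK.ge_mul (hρ _ (B _).2) (hK.ge_self q _)
        · rw [add_zero]
          exact hK.ge_mul (hρ _ (B _).2) (hK.ge_self q _)
  · intro q δ ρ hD hρ hq
    have hEfin : Module.Finite k (Submodule.span k (Set.range (f0 ∘ e))) :=
      Module.Finite.span_of_finite k (Set.finite_range _)
    obtain ⟨f', hf', hfE, hfg⟩ := hK.echelon q M (Submodule.span k (Set.range (f0 ∘ e))) hEfin ρ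
      (fun x hx => by
        induction hx using Submodule.span_induction with
        | mem x hx =>
          obtain ⟨i, rfl⟩ := hx
          have h1 := hK.ge_mul (hρ _ (β (e i).2).2) (hK.ge_self q (G (e i).1))
          rwa [hq, add_zero] at h1
        | zero => exact hK.ge_zero q _
        | add x y _ _ hx hy => exact hK.ge_add hx hy
        | smul c x _ hx => exact hK.ge_smul c hx)
      (by rw [finrank_span_eq_card hf, Fintype.card_fin])
    have h1 := hK.wr_bound D hker q δ hD M _ hf (Fintype.card_fin M) f' hf' hfE _ hfg
    rw [Finset.sum_add_distrib, Finset.sum_const, Finset.card_univ, Fintype.card_fin,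
      nsmul_eq_mul] at h1
    linarith

theorem core [CharZero k] (hK : IsFunctionField k v genus)
    {μ : Type*} [Fintype μ] (V U : Submodule k K) [Module.Finite k V] (hUV : U ≤ V)
    (G : μ → K) (hH : NonDeg V G) (hG0 : ∀ m, G m ≠ 0) (m0 : μ) (hm0 : G m0 = 1)
    (a : μ → K) (ha0 : a m0 ≠ 0) (haU : ∀ m, ∀ u ∈ U, a m * u ∈ V)
    (M : ℕ) (hM : M = Fintype.card μ * Module.finrank k V)
    (S : Finset Point) (hS : S.Nonempty) (hGS : ∀ q ∉ S, ∀ m, v q (G m) = 0)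
    (ρ : Point → ℤ) (hρ : ∀ q, ∀ x ∈ V, ge v q (ρ q) x) (T0 : Finset Point)
    (hT0 : ∀ q ∉ T0, ρ q = 0) :
    (Module.finrank k U : ℤ) * ∑ q ∈ S, v0 v q (∑ m, a m * G m) ≤
      (M : ℤ) * (- ∑ q ∈ T0, ρ q) + (∑ i : Fin M, (i : ℤ)) * (2 * (genus : ℤ) - 2 + S.card) := by
  obtain ⟨p, hp⟩ := hS
  obtain ⟨D, δ, T1, hker, hD, hT1, hδ⟩ := hK.exists_derivation p
  obtain ⟨W, hW0, hW1, hW2⟩ := hK.core_loc D hker V U hUV G hH hG0 m0 hm0 a ha0 haU M hM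
  have hGsum : ∀ m, ∑ q ∈ S, v q (G m) = 0 := by
    intro m
    rw [← hK.sum_v (G m) (hG0 m)]
    symm
    apply finsum_eq_sum_of_support_subset
    intro q hq
    by_contra h
    exact hq (hGS q h m)
  set s := ∑ i : Fin M, (i : ℤ) with hs
  have hs0 : 0 ≤ s := Finset.sum_nonneg fun i _ => by positivity
  let T := S ∪ T0 ∪ T1 ∪ (hK.finite_support W hW0).toFinset
  have hWsum : ∑ q ∈ T, v q W = 0 := by
    rw [← hK.sum_v W hW0]
    symm
    apply finsum_eq_sum_of_support_subset
    intro q hq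
    have : q ∈ (hK.finite_support W hW0).toFinset := by simpa using hq
    simp only [T, Finset.coe_union]
    exact Or.inr this
  let X : Point → ℤ := fun q => Module.finrank k V * ∑ m, v q (G m)
          + Module.finrank k U * v0 v q (∑ m, a m * G m) - s
  have hloc : ∀ q ∈ T, (M : ℤ) * ρ q + s * δ q + (if q ∈ S then X q else 0) ≤ v q W := by
    intro q _
    split_ifs with h
    · have := hW1 q (δ q) (ρ q) (hD q) (hρ q)
      simp only [X]
      linarith
    · have := hW2 q (δ q) (ρ q) (hD q) (hρ q) (hGS q h)
      linarith
  have hsum := Finset.sum_le_sum hloc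
  rw [hWsum, Finset.sum_add_distrib, Finset.sum_add_distrib, ← Finset.mul_sum, ← Finset.mul_sum,
    ← Finset.sum_filter] at hsum
  have e1 : T.filter (· ∈ S) = S := by
    ext q
    simp only [Finset.mem_filter, T, Finset.mem_union]
    tauto
  have e2 : ∑ q ∈ T, ρ q = ∑ q ∈ T0, ρ q := by
    symm
    apply Finset.sum_subset
    · intro q hq; simp only [T, Finset.mem_union]; tauto
    · intro q _ hq; exact hT0 q hq
  have e3 : ∑ q ∈ T, δ q = ∑ q ∈ T1, δ q := by
    symm
    apply Finset.sum_subset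
    · intro q hq; simp only [T, Finset.mem_union]; tauto
    · intro q _ hq; exact hT1 q hq
  have e4 : ∑ q ∈ S, X q = Module.finrank k U * ∑ q ∈ S, v0 v q (∑ m, a m * G m) - S.card * s := by
    simp only [X]
    rw [Finset.sum_sub_distrib, Finset.sum_add_distrib, ← Finset.mul_sum, ← Finset.mul_sum,
      Finset.sum_comm, Finset.sum_congr rfl fun m _ => hGsum m]
    simp
  rw [e1, e2, e3, e4] at hsum
  have h5 := mul_le_mul_of_nonneg_left hδ hs0
  linarith

end IsFunctionField
end curve
end FunctionFieldGCD

namespace FunctionFieldGCD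
section curve
variable {k K Point : Type*} [Field k] [Field K] [Algebra k K] {v : Point → K → ℤ} {genus : ℕ}

theorem exists_expo (n d : ℕ) : ∃ I : Finset (Fin n →₀ ℕ),
    (∀ m, m ∈ I ↔ (m.sum fun _ e => e) ≤ d) ∧ I.card = Nat.choose (n + d) n := by
  refine ⟨(Finset.finsuppAntidiag (Finset.univ : Finset (Fin (n + 1))) d).image Finsupp.tail,
    fun m => ?_, ?_⟩
  · rw [Finset.mem_image, Finsupp.sum_fintype _ _ (fun _ => rfl)]
    constructor
    · rintro ⟨x, hx, rfl⟩
      rw [Finset.mem_finsuppAntidiag] at hx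
      have h1 := hx.1
      rw [Fin.sum_univ_succ] at h1
      simp only [Finsupp.tail_apply]
      omega
    · intro h
      refine ⟨Finsupp.cons (d - ∑ i, m i) m, ?_, Finsupp.tail_cons _ _⟩
      rw [Finset.mem_finsuppAntidiag]
      refine ⟨?_, Finset.subset_univ _⟩
      rw [Fin.sum_univ_succ]
      simp only [Finsupp.cons_zero, Finsupp.cons_succ]
      omega
  · rw [Finset.card_image_of_injOn, Finset.card_finsuppAntidiag_nat_eq_choose]
    · rw [Finset.card_univ, Fintype.card_fin, show n + 1 + d - 1 = n + d by omega]
      exact (Nat.choose_symm_add).symm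
    · intro x hx y hy hxy
      have hx := (Finset.mem_finsuppAntidiag.1 hx).1
      have hy := (Finset.mem_finsuppAntidiag.1 hy).1
      rw [Fin.sum_univ_succ] at hx hy
      have h2 : ∀ i : Fin n, x i.succ = y i.succ := fun i => by
        have := congrArg (fun z => z i) hxy
        simpa [Finsupp.tail_apply] using this
      rw [Finset.sum_congr rfl fun i _ => h2 i] at hx
      ext i
      refine Fin.cases ?_ h2 i
      omega

theorem nondeg_of (V : Submodule k K) (n d : ℕ) (I : Finset (Fin n →₀ ℕ))
    (hI : ∀ m, m ∈ I ↔ (m.sum fun _ e => e) ≤ d) (g : Fin n → K)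
    (hnd : ∀ P : MvPolynomial (Fin n) K,
      (∀ mm, MvPolynomial.coeff mm P ∈ V) →
      P.totalDegree ≤ d → MvPolynomial.eval g P = 0 → P = 0) :
    NonDeg V (fun m : I => ∏ j, g j ^ (m : Fin n →₀ ℕ) j) := by
  intro c hc hsum
  let P : MvPolynomial (Fin n) K := ∑ m : I, MvPolynomial.monomial (m : Fin n →₀ ℕ) (c m)
  have hcoeff : ∀ m : I, MvPolynomial.coeff (m : Fin n →₀ ℕ) P = c m := by
    intro m
    simp only [P, MvPolynomial.coeff_sum, MvPolynomial.coeff_monomial]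
    rw [Finset.sum_eq_single m]
    · simp
    · intro b _ hb
      rw [if_neg fun h => hb (Subtype.ext h)]
    · simp
  have hcoeff0 : ∀ m, m ∉ I → MvPolynomial.coeff m P = 0 := by
    intro m hm
    simp only [P, MvPolynomial.coeff_sum, MvPolynomial.coeff_monomial]
    refine Finset.sum_eq_zero fun b _ => ?_
    rw [if_neg]
    rintro rfl
    exact hm b.2
  have hP : P = 0 := by
    apply hnd
    · intro mm
      by_cases h : mm ∈ I
      · rw [hcoeff ⟨mm, h⟩]; exact hc _
      · rw [hcoeff0 mm h]; exact V.zero_mem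
    · refine Finset.sup_le fun m hm => ?_
      rw [← hI]
      by_contra h
      exact (MvPolynomial.mem_support_iff.1 hm) (hcoeff0 m h)
    · rw [← hsum]
      simp only [P, map_sum, MvPolynomial.eval_monomial]
      refine Finset.sum_congr rfl fun m _ => ?_
      rw [Finsupp.prod_fintype _ _ (fun i => pow_zero _)]
  intro m
  rw [← hcoeff m, hP, MvPolynomial.coeff_zero]

theorem final_real (L dU dV C d n mh r h t s M : ℝ) (hdU : 0 < dU) (hUV : dU ≤ dV) (hC : 1 ≤ C)
    (hd : 0 ≤ d) (hn : 0 ≤ n) (hmh : 0 ≤ mh) (hh : 0 ≤ h) (hM : M = C * dV)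
    (hs : 2 * s = M * (M - 1)) (hmain : dU * L ≤ M * (r * h) + s * max 0 t) :
    L ≤ (dV / dU - 1) * (C - 1 + 1) * d * n * mh + (dV * (C - 1 + 1) / dU) * (r + 1) * h
      + (dV * (C - 1 + 1) * ((C - 1) * dV + dV - 1) / (2 * dU)) * max 0 t := by
  rw [← mul_le_mul_iff_right₀ hdU]
  have hs' : s = M * (M - 1) / 2 := by linarith
  have e : dU * ((dV / dU - 1) * (C - 1 + 1) * d * n * mh + (dV * (C - 1 + 1) / dU) * (r + 1) * h
      + (dV * (C - 1 + 1) * ((C - 1) * dV + dV - 1) / (2 * dU)) * max 0 t) =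
      (dV - dU) * C * d * n * mh + M * h + (M * (r * h) + s * max 0 t) := by
    rw [hs', hM]
    field_simp
    ring
  rw [e]
  have h1 : 0 ≤ (dV - dU) * C * d * n * mh := by
    have : 0 ≤ dV - dU := by linarith
    have : 0 ≤ C := by linarith
    positivity
  have h2 : 0 ≤ M * h := by
    rw [hM]
    have : 0 ≤ dV := by linarith
    have : 0 ≤ C := by linarith
    positivity
  linarith

theorem coeff_mem (n : ℕ) (F : MvPolynomial (Fin n) K) (m : Fin n →₀ ℕ) :
    MvPolynomial.coeff m F ∈ coeffSpan1 k F := by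
  by_cases h : m ∈ F.support
  · exact Submodule.subset_span ⟨m, h, rfl⟩
  · rw [MvPolynomial.notMem_support_iff.1 h]; exact Submodule.zero_mem _

theorem sum_fin_two (M : ℕ) (hM : 1 ≤ M) : 2 * (∑ i : Fin M, (i : ℤ)) = M * (M - 1) := by
  rw [Fin.sum_univ_eq_sum_range (fun i => (i : ℤ)) M]
  have := Finset.sum_range_id_mul_two M
  zify [hM] at this
  linarith

end curve
end FunctionFieldGCD

namespace FunctionFieldGCD

variable {K : Type*} [Field K] {Point : Type*}

/-- **Theorem 6.4 (the `S`-part of `F(g)`).**  Let `F` have degree `d > 0`, not vanish at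
the origin, and have a coefficient equal to `1`.  Put `N = C(n+d,n) − 1`.  If the monomials
`g^i`, `|i| ≤ d`, are linearly nondegenerate over `V_F(r)`, then
`Σ_{𝔭∈S} v_𝔭^0(F(g)) ≤ (d_r/d_{r−1} − 1)(N+1)dn·max_i h(g_i) + (d_r(N+1)/d_{r−1})(r+1)h(F)
+ (d_r(N+1)(N·d_r+d_r−1)/(2d_{r−1}))·max{0, 2𝔤−2+|S|}`. -/
theorem S_part_estimate
    (k K Point : Type*) [Field k] [Field K] [Algebra k K] [IsAlgClosed k] [CharZero k]
    (v : Point → K → ℤ) (genus : ℕ) (hK : IsFunctionField k v genus)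
    (n d : ℕ) (hd : 0 < d)
    (F : MvPolynomial (Fin n) K) (hdeg : F.totalDegree = d)
    (hF0 : MvPolynomial.eval (fun _ => (0 : K)) F ≠ 0)
    (hc : ∃ mm ∈ F.support, MvPolynomial.coeff mm F = 1)
    (S : Set Point) (hS : S.Finite)
    (g : Fin n → K) (hg : ∀ i, IsSUnit v S (g i))
    (r : ℕ) (hr : 0 < r)
    (hnd : ∀ P : MvPolynomial (Fin n) K,
      (∀ mm, MvPolynomial.coeff mm P ∈ (coeffSpan1 k F) ^ r) →
      P.totalDegree ≤ d → MvPolynomial.eval g P = 0 → P = 0) :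
    ((∑ᶠ p ∈ S, v0 v p (MvPolynomial.eval g F)) : ℝ)
      ≤ ((Module.finrank k ↥((coeffSpan1 k F) ^ r) : ℝ)
              / (Module.finrank k ↥((coeffSpan1 k F) ^ (r - 1)) : ℝ) - 1)
            * ((Nat.choose (n + d) n : ℝ) - 1 + 1) * (d : ℝ) * (n : ℝ) * (maxHeight v g : ℝ)
        + ((Module.finrank k ↥((coeffSpan1 k F) ^ r) : ℝ)
              * ((Nat.choose (n + d) n : ℝ) - 1 + 1)
              / (Module.finrank k ↥((coeffSpan1 k F) ^ (r - 1)) : ℝ))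
            * ((r : ℝ) + 1) * (hPoly v F : ℝ)
        + ((Module.finrank k ↥((coeffSpan1 k F) ^ r) : ℝ)
              * ((Nat.choose (n + d) n : ℝ) - 1 + 1)
              * (((Nat.choose (n + d) n : ℝ) - 1) * (Module.finrank k ↥((coeffSpan1 k F) ^ r) : ℝ)
                  + (Module.finrank k ↥((coeffSpan1 k F) ^ r) : ℝ) - 1)
              / (2 * (Module.finrank k ↥((coeffSpan1 k F) ^ (r - 1)) : ℝ)))
            * max 0 (2 * (genus : ℝ) - 2 + (S.ncard : ℝ)) := by
  obtain ⟨mc, hmc, hmc1⟩ := hc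
  have hne : F.support.Nonempty := ⟨mc, hmc⟩
  have h1V : (1 : Submodule k K) ≤ coeffSpan1 k F := by
    rw [Submodule.one_le, ← hmc1]; exact coeff_mem n F mc
  have hfg : (coeffSpan1 k F).FG :=
    Submodule.fg_span (F.support.finite_toSet.image _)
  have hfgr : ∀ s, Module.Finite k ↥((coeffSpan1 k F) ^ s) := fun s =>
    Module.Finite.iff_fg.2 (hfg.pow s)
  have hfinr := hfgr r
  have hfinr1 := hfgr (r - 1)
  have hsucc : (coeffSpan1 k F) ^ r = coeffSpan1 k F * (coeffSpan1 k F) ^ (r - 1) := by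
    rw [← pow_succ']; congr 1; omega
  have hUV : (coeffSpan1 k F) ^ (r - 1) ≤ (coeffSpan1 k F) ^ r := by
    rw [hsucc]
    calc (coeffSpan1 k F) ^ (r - 1) = 1 * (coeffSpan1 k F) ^ (r - 1) := (one_mul _).symm
      _ ≤ _ := mul_le_mul' h1V le_rfl
  have hone : ∀ s, (1 : K) ∈ (coeffSpan1 k F) ^ s := by
    intro s
    have := Submodule.pow_mem_pow (coeffSpan1 k F) (Submodule.one_le.1 h1V) s
    rwa [one_pow] at this
  have hUpos : 0 < Module.finrank k ↥((coeffSpan1 k F) ^ (r - 1)) := by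
    have : Nontrivial ↥((coeffSpan1 k F) ^ (r - 1)) :=
      ⟨⟨⟨1, hone _⟩, 0, fun h => one_ne_zero (congrArg Subtype.val h)⟩⟩
    exact Module.finrank_pos
  have hUVr : Module.finrank k ↥((coeffSpan1 k F) ^ (r - 1)) ≤
      Module.finrank k ↥((coeffSpan1 k F) ^ r) := Submodule.finrank_mono hUV
  -- local bounds
  have hvle : ∀ q, vPoly v q F ≤ 0 := by
    intro q
    rw [vPoly, dif_pos hne]
    refine (Finset.inf'_le _ hmc).trans ?_
    rw [hmc1, hK.v_one]
  have hV1 : ∀ q, ∀ x ∈ coeffSpan1 k F, ge v q (vPoly v q F) x := by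
    intro q x hx
    induction hx using Submodule.span_induction with
    | mem x hx =>
      obtain ⟨m, hm, rfl⟩ := hx
      right
      rw [vPoly, dif_pos hne]
      exact Finset.inf'_le _ hm
    | zero => exact hK.ge_zero q _
    | add x y _ _ hx hy => exact hK.ge_add hx hy
    | smul c x _ hx => exact hK.ge_smul c hx
  have hVr : ∀ s : ℕ, ∀ q, ∀ x ∈ (coeffSpan1 k F) ^ s, ge v q (s * vPoly v q F) x := by
    intro s q
    induction s with
    | zero =>
      intro x hx
      rw [pow_zero, Submodule.mem_one] at hx
      obtain ⟨c, rfl⟩ := hx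
      simpa using hK.ge_const q c
    | succ s ih =>
      intro x hx
      rw [pow_succ] at hx
      refine Submodule.mul_induction_on hx (fun a ha b hb => ?_) (fun x y hx hy => hK.ge_add hx hy)
      have := hK.ge_mul (ih a ha) (hV1 q b hb)
      refine hK.ge_mono (le_of_eq ?_) this
      push_cast; ring
  let T0 : Finset Point := F.support.attach.biUnion fun m =>
    (hK.finite_support _ (MvPolynomial.mem_support_iff.1 m.2)).toFinset
  have hT0 : ∀ q ∉ T0, vPoly v q F = 0 := by
    intro q hq
    rw [vPoly, dif_pos hne]
    have h1 : ∀ m ∈ F.support, v q (MvPolynomial.coeff m F) = 0 := by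
      intro m hm
      by_contra h
      apply hq
      rw [Finset.mem_biUnion]
      exact ⟨⟨m, hm⟩, Finset.mem_attach _ _, by simpa using h⟩
    apply le_antisymm
    · exact (Finset.inf'_le _ hmc).trans (h1 mc hmc).le
    · exact Finset.le_inf' _ _ fun m hm => (h1 m hm).ge
  have hh : hPoly v F = - ∑ q ∈ T0, vPoly v q F := by
    rw [hPoly, ← Finset.sum_neg_distrib]
    apply finsum_eq_sum_of_support_subset
    intro q hq
    by_contra h
    exact hq (by simp [hT0 q h])
  have hh0 : 0 ≤ hPoly v F := by
    rw [hh, neg_nonneg]; exact Finset.sum_nonpos fun q _ => hvle q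
  have hmh0 : 0 ≤ maxHeight v g := by rw [maxHeight]; positivity
  obtain ⟨I, hI, hIc⟩ := exists_expo n d
  have hnon := nondeg_of _ n d I hI g hnd
  have hC1 : 1 ≤ Nat.choose (n + d) n := Nat.choose_pos (Nat.le_add_right _ _)
  have hsumF : MvPolynomial.eval g F =
      ∑ m : I, MvPolynomial.coeff (m : Fin n →₀ ℕ) F * ∏ j, g j ^ (m : Fin n →₀ ℕ) j := by
    rw [MvPolynomial.eval_eq', Finset.sum_coe_sort I
      (fun m => MvPolynomial.coeff m F * ∏ j, g j ^ m j)]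
    apply Finset.sum_subset
    · intro m hm
      rw [hI, ← hdeg]
      exact MvPolynomial.le_totalDegree hm
    · intro m _ hm
      rw [MvPolynomial.notMem_support_iff.1 hm, zero_mul]
  have h0I : (0 : Fin n →₀ ℕ) ∈ I := by rw [hI]; simp
  have hM1 : 1 ≤ Nat.choose (n + d) n * Module.finrank k ↥((coeffSpan1 k F) ^ r) :=
    Nat.mul_pos hC1 (lt_of_lt_of_le hUpos hUVr)
  obtain ⟨M, hM⟩ : ∃ M, M = Nat.choose (n + d) n * Module.finrank k ↥((coeffSpan1 k F) ^ r) :=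
    ⟨_, rfl⟩
  rw [← hM] at hM1
  have hs2 := sum_fin_two M hM1
  have hs0 : 0 ≤ ∑ i : Fin M, (i : ℤ) := Finset.sum_nonneg fun i _ => by positivity
  rw [finsum_mem_eq_finite_toFinset_sum _ hS, ← Int.cast_sum]
  refine final_real _ _ _ _ _ _ _ _ _ _ ((∑ i : Fin M, (i : ℤ) : ℤ) : ℝ) M (by exact_mod_cast hUpos)
    (by exact_mod_cast hUVr) (by exact_mod_cast hC1) (by positivity) (by positivity)
    (by exact_mod_cast hmh0) (by exact_mod_cast hh0) (by rw [hM]; push_cast; rfl)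
    (by exact_mod_cast hs2) ?_
  by_cases hSe : S = ∅
  · have : hS.toFinset = ∅ := by simpa using hSe
    rw [this, Finset.sum_empty, Int.cast_zero, mul_zero]
    have h1 : (0 : ℝ) ≤ ((∑ i : Fin M, (i : ℤ) : ℤ) : ℝ) := by exact_mod_cast hs0
    have h2 : (0 : ℝ) ≤ (hPoly v F : ℝ) := by exact_mod_cast hh0
    positivity
  · have hg0 : ∀ i, g i ≠ 0 := fun i => (hg i).1
    have hcore := hK.core ((coeffSpan1 k F) ^ r) ((coeffSpan1 k F) ^ (r - 1)) hUV
      (fun m : I => ∏ j, g j ^ (m : Fin n →₀ ℕ) j) hnon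
      (fun m => Finset.prod_ne_zero_iff.2 fun j _ => pow_ne_zero _ (hg0 j)) ⟨0, h0I⟩ (by simp)
      (fun m => MvPolynomial.coeff (m : Fin n →₀ ℕ) F)
      (by rw [MvPolynomial.eval_zero', MvPolynomial.constantCoeff_eq] at hF0; exact hF0)
      (fun m u hu => by rw [hsucc]; exact Submodule.mul_mem_mul (coeff_mem n F _) hu)
      M (by rw [Fintype.card_coe, hIc, hM]) hS.toFinset
      (by rw [Set.Finite.toFinset_nonempty]; exact Set.nonempty_iff_ne_empty.2 hSe)
      (fun q hq m => by
        have hq' : q ∉ S := by simpa using hq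
        have h1 : ∀ s : Finset (Fin n), v q (∏ j ∈ s, g j ^ (m : Fin n →₀ ℕ) j) = 0 := by
          intro s
          induction s using Finset.induction_on with
          | empty => simp [hK.v_one]
          | insert j s hj ih =>
            rw [Finset.prod_insert hj, hK.v_mul q _ _ (pow_ne_zero _ (hg0 j))
              (Finset.prod_ne_zero_iff.2 fun j _ => pow_ne_zero _ (hg0 j)), ih,
              hK.v_pow q _ (hg0 j), (hg j).2 q hq']
            simp
        exact h1 _)
      (fun q => r * vPoly v q F) (fun q x hx => hVr r q x hx) T0
      (fun q hq => by rw [hT0 q hq, mul_zero])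
    rw [← hsumF, ← Finset.mul_sum, ← mul_neg, ← hh, ← Set.ncard_eq_toFinset_card S hS] at hcore
    have hcR : ((Module.finrank k ↥((coeffSpan1 k F) ^ (r - 1)) : ℝ)) *
        ((∑ q ∈ hS.toFinset, v0 v q (MvPolynomial.eval g F) : ℤ) : ℝ) ≤
        (M : ℝ) * (r * (hPoly v F : ℝ)) + ((∑ i : Fin M, (i : ℤ) : ℤ) : ℝ) *
          (2 * (genus : ℝ) - 2 + (S.ncard : ℝ)) := by exact_mod_cast hcore
    refine hcR.trans ?_
    have h1 : (0 : ℝ) ≤ ((∑ i : Fin M, (i : ℤ) : ℤ) : ℝ) := by exact_mod_cast hs0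
    have := mul_le_mul_of_nonneg_left (le_max_right 0 (2 * (genus : ℝ) - 2 + (S.ncard : ℝ))) h1
    linarith

end FunctionFieldGCD
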